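/- Let f ∈ ℝ[x,y,z] be homogeneous of degree 4 defining a smooth complex plane quartic Q = V(f), and let L∞ = V(ℓ∞) be a real line such that no real point of Q lies on L∞ (i.e. f(p) ≠ 0 for every nonzero p ∈ ℝ³ with ℓ∞(p) = 0 — in fact it suffices that f and ℓ∞ have no common real projective zero) and such that L∞ is not itself a bitangent of Q. Then Q has only finitely many real bitangents, every real bitangent has its tangency points off L∞ so that its Qtype relative to L∞ is defined, and (number of real bitangents L with Qtype_{L∞}(L) = +1) − (number of real bitangents L with Qtype_{L∞}(L) = −1) = 4. -/

import Mathlib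

open MvPolynomial

noncomputable section

/-- Complexification of a real ternary polynomial. -/
def cmap (f : MvPolynomial (Fin 3) ℝ) : MvPolynomial (Fin 3) ℂ :=
  MvPolynomial.map (algebraMap ℝ ℂ) f

/-- Evaluation of the complexification of `f` at a complex point. -/
def cev (f : MvPolynomial (Fin 3) ℝ) (p : Fin 3 → ℂ) : ℂ :=
  eval p (cmap f)

/-- The linear form with coefficient vector `ℓ`, evaluated at `p`. -/
def lin {R : Type*} [CommSemiring R] (ℓ p : Fin 3 → R) : R := ∑ i, ℓ i * p i

/-- The complexification of a real vector. -/
def cvec (v : Fin 3 → ℝ) : Fin 3 → ℂ := fun i => (v i : ℂ)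

/-- Smoothness of the complex plane curve V(f): the gradient is nonzero at every
nonzero complex zero of `f`. -/
def SmoothQuartic (f : MvPolynomial (Fin 3) ℝ) : Prop :=
  ∀ p : Fin 3 → ℂ, p ≠ 0 → cev f p = 0 → ∃ i, eval p (pderiv i (cmap f)) ≠ 0

/-- The line `V(ℓ)` is a bitangent of `V(f)` with tangency points `z₁, z₂`:
the restriction of `f` to the line is a nonzero scalar multiple of the square of a
nonzero quadratic form on the line, whose zeros (with multiplicity) are `z₁, z₂`.
Over ℂ the quadratic form is written as the product of two linear forms `m₁, m₂`,
each nonzero on the line and vanishing at the corresponding tangency point. -/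
def IsBitangentAt (f : MvPolynomial (Fin 3) ℝ) (ℓ z₁ z₂ : Fin 3 → ℂ) : Prop :=
  ℓ ≠ 0 ∧ z₁ ≠ 0 ∧ z₂ ≠ 0 ∧ lin ℓ z₁ = 0 ∧ lin ℓ z₂ = 0 ∧
  ∃ (m₁ m₂ : Fin 3 → ℂ) (c : ℂ), c ≠ 0 ∧
    lin m₁ z₁ = 0 ∧ lin m₂ z₂ = 0 ∧
    (∃ p, lin ℓ p = 0 ∧ lin m₁ p ≠ 0) ∧
    (∃ p, lin ℓ p = 0 ∧ lin m₂ p ≠ 0) ∧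
    (∀ p, lin ℓ p = 0 → cev f p = c * (lin m₁ p * lin m₂ p) ^ 2)

/-- The line `V(ℓ)` is a bitangent of the quartic `V(f)`. -/
def IsBitangent (f : MvPolynomial (Fin 3) ℝ) (ℓ : Fin 3 → ℂ) : Prop :=
  ∃ z₁ z₂, IsBitangentAt f ℓ z₁ z₂

/-- The set of real bitangent lines of `V(f)`, as points of the real projective
plane of lines. -/
def realBitangents (f : MvPolynomial (Fin 3) ℝ) :
    Set (Projectivization ℝ (Fin 3 → ℝ)) :=
  {L | IsBitangent f (cvec L.rep)}

/-- Directional derivative of (the complexification of) `f` along the real vector `v`. -/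
def Dv (f : MvPolynomial (Fin 3) ℝ) (v : Fin 3 → ℝ) (z : Fin 3 → ℂ) : ℂ :=
  ∑ i, (v i : ℂ) * eval z (pderiv i (cmap f))

/-- `Qtype_{L∞}(L) = ε ∈ {+1, -1}` for the real bitangent `L = V(ℓ)` of `V(f)`,
relative to the real line at infinity `V(ℓinf)`: for tangency points normalized so
that `ℓ∞(z̃ᵢ) = 1` and any real `v` with `ℓ(v) ≠ 0`, the product
`(D_v f)(z̃₁)·(D_v f)(z̃₂)` is a nonzero real number of sign `ε`. -/
def HasQtype (f : MvPolynomial (Fin 3) ℝ) (ℓinf : Fin 3 → ℝ) (ℓ : Fin 3 → ℂ)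
    (ε : ℤ) : Prop :=
  ∃ (z₁ z₂ : Fin 3 → ℂ) (v : Fin 3 → ℝ) (r : ℝ),
    IsBitangentAt f ℓ z₁ z₂ ∧
    lin (cvec ℓinf) z₁ = 1 ∧ lin (cvec ℓinf) z₂ = 1 ∧
    lin ℓ (cvec v) ≠ 0 ∧
    Dv f v z₁ * Dv f v z₂ = (r : ℂ) ∧
    ((0 < r ∧ ε = 1) ∨ (r < 0 ∧ ε = -1))

/-- A point of ℙ²(ℂ) (given by a nonzero vector) is real. -/
def IsRealPoint (z : Fin 3 → ℂ) : Prop :=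
  ∃ (w : Fin 3 → ℝ) (t : ℂ), w ≠ 0 ∧ t ≠ 0 ∧ z = t • cvec w


/-- The Jacobian determinant of the planar map `(u, v)`. -/
def jac (u v : ℝ × ℝ → ℝ) (p : ℝ × ℝ) : ℝ :=
  fderiv ℝ u p (1, 0) * fderiv ℝ v p (0, 1) - fderiv ℝ u p (0, 1) * fderiv ℝ v p (1, 0)

/-- The component along `e` of the one-form `H (u² + v²) (u dv - v du)`. -/
def angForm (H : ℝ → ℝ) (u v : ℝ × ℝ → ℝ) (e p : ℝ × ℝ) : ℝ :=
  H (u p ^ 2 + v p ^ 2) * (u p * fderiv ℝ v p e - v p * fderiv ℝ u p e)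

lemma hasFDerivAt_angForm {H : ℝ → ℝ} {u v : ℝ × ℝ → ℝ} (hH : ContDiff ℝ 1 H)
    (hu : ContDiff ℝ 2 u) (hv : ContDiff ℝ 2 v) (e p : ℝ × ℝ) :
    ∃ D : ℝ × ℝ →L[ℝ] ℝ, HasFDerivAt (angForm H u v e) D p ∧ ∀ e', D e' =
      deriv H (u p ^ 2 + v p ^ 2) * (2 * u p * fderiv ℝ u p e' + 2 * v p * fderiv ℝ v p e') *
        (u p * fderiv ℝ v p e - v p * fderiv ℝ u p e) +
      H (u p ^ 2 + v p ^ 2) * (fderiv ℝ u p e' * fderiv ℝ v p e - fderiv ℝ v p e' * fderiv ℝ u p e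
        + u p * fderiv ℝ (fderiv ℝ v) p e' e - v p * fderiv ℝ (fderiv ℝ u) p e' e) := by
  have hu1 : HasFDerivAt u (fderiv ℝ u p) p :=
    (hu.differentiable (by norm_num)).differentiableAt.hasFDerivAt
  have hv1 : HasFDerivAt v (fderiv ℝ v p) p :=
    (hv.differentiable (by norm_num)).differentiableAt.hasFDerivAt
  have hu2 : HasFDerivAt (fun q => fderiv ℝ u q e) ((fderiv ℝ (fderiv ℝ u) p).flip e) p := by
    have : HasFDerivAt (fderiv ℝ u) (fderiv ℝ (fderiv ℝ u) p) p :=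
      (((hu.fderiv_right (m := 1) (by norm_num)).differentiable
        (by norm_num)).differentiableAt).hasFDerivAt
    simpa using this.clm_apply (hasFDerivAt_const e p)
  have hv2 : HasFDerivAt (fun q => fderiv ℝ v q e) ((fderiv ℝ (fderiv ℝ v) p).flip e) p := by
    have : HasFDerivAt (fderiv ℝ v) (fderiv ℝ (fderiv ℝ v) p) p :=
      (((hv.fderiv_right (m := 1) (by norm_num)).differentiable
        (by norm_num)).differentiableAt).hasFDerivAt
    simpa using this.clm_apply (hasFDerivAt_const e p)
  have hH1 : HasDerivAt H (deriv H (u p ^ 2 + v p ^ 2)) (u p ^ 2 + v p ^ 2) :=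
    (hH.differentiable (by norm_num)).differentiableAt.hasDerivAt
  have hs := (hu1.pow 2).add (hv1.pow 2)
  have := (hH1.comp_hasFDerivAt p hs).mul ((hu1.mul hv2).sub (hv1.mul hu2))
  refine ⟨_, this, fun e' => ?_⟩
  simp
  ring

lemma continuous_angForm {H : ℝ → ℝ} {u v : ℝ × ℝ → ℝ} (hH : ContDiff ℝ 1 H)
    (hu : ContDiff ℝ 2 u) (hv : ContDiff ℝ 2 v) (e : ℝ × ℝ) : Continuous (angForm H u v e) :=
  continuous_iff_continuousAt.2 fun p =>
    (hasFDerivAt_angForm hH hu hv e p).choose_spec.1.continuousAt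

lemma continuous_jac {u v : ℝ × ℝ → ℝ} (hu : ContDiff ℝ 2 u) (hv : ContDiff ℝ 2 v) :
    Continuous (jac u v) := by
  have h1 := hu.continuous_fderiv (by norm_num)
  have h2 := hv.continuous_fderiv (by norm_num)
  unfold jac
  fun_prop

/-- Green's formula for the regularised angular form of a planar map on a rectangle. -/
lemma green_angForm {H : ℝ → ℝ} {u v : ℝ × ℝ → ℝ} (hH : ContDiff ℝ 1 H)
    (hu : ContDiff ℝ 2 u) (hv : ContDiff ℝ 2 v) {a b c d : ℝ} (hab : a ≤ b) (hcd : c ≤ d) :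
    ∫ p in Set.Icc (a, c) (b, d),
      2 * deriv (fun s => s * H s) (u p ^ 2 + v p ^ 2) * jac u v p =
    (∫ x in a..b, angForm H u v (1, 0) (x, c)) - (∫ x in a..b, angForm H u v (1, 0) (x, d)) +
      (∫ y in c..d, angForm H u v (0, 1) (b, y)) - ∫ y in c..d, angForm H u v (0, 1) (a, y) := by
  choose f' hf' hf using hasFDerivAt_angForm hH hu hv (0, 1)
  choose g' hg' hg using hasFDerivAt_angForm hH hu hv (1, 0)
  have key : ∀ p, f' p (1, 0) + (-g' p) (0, 1) =
      2 * deriv (fun s => s * H s) (u p ^ 2 + v p ^ 2) * jac u v p := by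
    intro p
    have hd : deriv (fun s => s * H s) (u p ^ 2 + v p ^ 2) =
        H (u p ^ 2 + v p ^ 2) + (u p ^ 2 + v p ^ 2) * deriv H (u p ^ 2 + v p ^ 2) := by
      have := (hasDerivAt_id (u p ^ 2 + v p ^ 2)).mul
        ((hH.differentiable (by norm_num)).differentiableAt
          (x := u p ^ 2 + v p ^ 2)).hasDerivAt
      rw [show (fun s => s * H s) = id * H from rfl, this.deriv]
      simp
    have su : fderiv ℝ (fderiv ℝ u) p (1, 0) (0, 1) = fderiv ℝ (fderiv ℝ u) p (0, 1) (1, 0) :=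
      (hu.contDiffAt.isSymmSndFDerivAt (by simp)).eq _ _
    have sv : fderiv ℝ (fderiv ℝ v) p (1, 0) (0, 1) = fderiv ℝ (fderiv ℝ v) p (0, 1) (1, 0) :=
      (hv.contDiffAt.isSymmSndFDerivAt (by simp)).eq _ _
    rw [neg_apply, hf, hg, hd, su, sv, jac]
    ring
  have hcont : Continuous fun p => 2 * deriv (fun s => s * H s) (u p ^ 2 + v p ^ 2) * jac u v p := by
    have h1 := continuous_jac hu hv
    have h2 : Continuous (deriv fun s => s * H s) :=
      (contDiff_id.mul hH).continuous_deriv (by norm_num)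
    have h3 := hu.continuous
    have h4 := hv.continuous
    fun_prop
  have := MeasureTheory.integral_divergence_prod_Icc_of_hasFDerivAt_of_le
    (angForm H u v (0, 1)) (fun p => -angForm H u v (1, 0) p) f' (fun p => -g' p) (a, c) (b, d)
    ⟨hab, hcd⟩ (continuous_angForm hH hu hv _).continuousOn
    (continuous_angForm hH hu hv _).neg.continuousOn
    (fun x _ => hf' x) (fun x _ => (hg' x).neg)
    (by simp_rw [key]; exact hcont.continuousOn.integrableOn_Icc)
  simp_rw [key] at this
  rw [this]
  simp only [intervalIntegral.integral_neg]
  ring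

/-- A regularisation of `s ↦ 1 / s` that agrees with it for `s ≥ δ`. -/
def regInv (δ s : ℝ) : ℝ := Real.smoothTransition (2 * s / δ - 1) / s

lemma regInv_of_le {δ s : ℝ} (hδ : 0 < δ) (h : δ ≤ s) : regInv δ s = 1 / s := by
  rw [regInv, Real.smoothTransition.one_of_one_le]
  have : 1 ≤ s / δ := (one_le_div hδ).2 h
  rw [mul_div_assoc]; linarith

lemma contDiff_regInv {δ : ℝ} (hδ : 0 < δ) : ContDiff ℝ 1 (regInv δ) := by
  rw [contDiff_iff_contDiffAt]
  intro s
  by_cases hs : s < δ / 2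
  · have : regInv δ =ᶠ[nhds s] fun _ => 0 := by
      filter_upwards [gt_mem_nhds hs] with t ht
      rw [regInv, Real.smoothTransition.zero_of_nonpos, zero_div]
      have : 2 * t / δ < 1 := by rw [div_lt_one hδ]; linarith
      linarith
    exact contDiffAt_const.congr_of_eventuallyEq this
  · have h0 : s ≠ 0 := by intro h; apply hs; rw [h]; positivity
    have h1 : ContDiff ℝ 1 fun s : ℝ => Real.smoothTransition (2 * s / δ - 1) :=
      Real.smoothTransition.contDiff.comp (by fun_prop)
    exact h1.contDiffAt.div contDiffAt_id h0

lemma mul_regInv_of_le {δ s : ℝ} (hδ : 0 < δ) (h : δ ≤ s) : s * regInv δ s = 1 := by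
  rw [regInv_of_le hδ h, mul_one_div_cancel (hδ.trans_le h).ne']

lemma deriv_mul_regInv_of_le {δ s : ℝ} (hδ : 0 < δ) (h : δ ≤ s) :
    deriv (fun s => s * regInv δ s) s = 0 := by
  have hd : DifferentiableAt ℝ (fun s => s * regInv δ s) s :=
    differentiableAt_id.mul ((contDiff_regInv hδ).differentiable (by norm_num)).differentiableAt
  have h1 := hd.hasDerivAt.hasDerivWithinAt (s := Set.Ici s)
  have h2 : HasDerivWithinAt (fun s => s * regInv δ s) 0 (Set.Ici s) s :=
    (hasDerivWithinAt_const s (Set.Ici s) (1 : ℝ)).congr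
      (fun x hx => mul_regInv_of_le hδ (h.trans hx)) (mul_regInv_of_le hδ h)
  exact (uniqueDiffWithinAt_Ici s).eq_deriv _ h1 h2

/-- The regularised area form has total mass `2π` on the disc where it is supported. -/
lemma integral_disc_deriv_regInv {δ : ℝ} (hδ : 0 < δ) :
    ∫ p in {p : ℝ × ℝ | p.1 ^ 2 + p.2 ^ 2 < δ},
      2 * deriv (fun s => s * regInv δ s) (p.1 ^ 2 + p.2 ^ 2) = 2 * Real.pi := by
  set k : ℝ → ℝ := deriv fun s => s * regInv δ s with hk
  have hC : ContDiff ℝ 1 fun s => s * regInv δ s := contDiff_id.mul (contDiff_regInv hδ)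
  have hkc : Continuous k := hC.continuous_deriv (by norm_num)
  have hm : MeasurableSet {p : ℝ × ℝ | p.1 ^ 2 + p.2 ^ 2 < δ} :=
    (isOpen_lt (by fun_prop) continuous_const).measurableSet
  have h0 : ∫ p in {p : ℝ × ℝ | p.1 ^ 2 + p.2 ^ 2 < δ}, 2 * k (p.1 ^ 2 + p.2 ^ 2) =
      ∫ p : ℝ × ℝ, 2 * k (p.1 ^ 2 + p.2 ^ 2) := by
    apply MeasureTheory.setIntegral_eq_integral_of_forall_compl_eq_zero
    intro p hp
    rw [hk, deriv_mul_regInv_of_le hδ (not_lt.1 hp), mul_zero]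
  rw [h0, ← integral_comp_polarCoord_symm]
  have h1 : ∀ p : ℝ × ℝ, p.1 • (2 * k ((polarCoord.symm p).1 ^ 2 + (polarCoord.symm p).2 ^ 2)) =
      (p.1 * (2 * k (p.1 ^ 2))) * (1 : ℝ) := by
    intro p
    have : (p.1 * Real.cos p.2) ^ 2 + (p.1 * Real.sin p.2) ^ 2 = p.1 ^ 2 := by
      linear_combination p.1 ^ 2 * Real.cos_sq_add_sin_sq p.2
    simp only [polarCoord_symm_apply, this, smul_eq_mul, mul_one]
  simp_rw [h1]
  rw [polarCoord_target, MeasureTheory.Measure.volume_eq_prod,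
    MeasureTheory.setIntegral_prod_mul (fun r : ℝ => r * (2 * k (r ^ 2))) (fun _ => (1 : ℝ))]
  have h2 : ∫ r in Set.Ioi (0 : ℝ), r * (2 * k (r ^ 2)) = 1 := by
    have hs : ∫ r in Set.Ioi (0 : ℝ), r * (2 * k (r ^ 2)) =
        ∫ r in Set.Ioc (0 : ℝ) (Real.sqrt δ), r * (2 * k (r ^ 2)) := by
      apply MeasureTheory.setIntegral_eq_of_subset_of_forall_sdiff_eq_zero measurableSet_Ioi
      · exact fun x hx => hx.1
      · rintro x ⟨hx, hx'⟩
        have hx0 : 0 < x := hx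
        have : Real.sqrt δ < x := by
          by_contra h; exact hx' ⟨hx, not_lt.1 h⟩
        rw [hk, deriv_mul_regInv_of_le hδ ((Real.sqrt_le_left hx0.le).1 this.le)]
        ring
    rw [hs, ← intervalIntegral.integral_of_le (Real.sqrt_nonneg _)]
    have hder : ∀ r ∈ Set.uIcc 0 (Real.sqrt δ),
        HasDerivAt (fun r : ℝ => r ^ 2 * regInv δ (r ^ 2)) (r * (2 * k (r ^ 2))) r := by
      intro r _
      have hd : HasDerivAt (fun s => s * regInv δ s) (k (r ^ 2)) (r ^ 2) :=
        ((hC.differentiable (by norm_num)).differentiableAt).hasDerivAt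
      have := HasDerivAt.comp (h := fun r : ℝ => r ^ 2) r hd (hasDerivAt_pow 2 r)
      exact this.congr_deriv (by push_cast; ring)
    rw [intervalIntegral.integral_eq_sub_of_hasDerivAt hder
      (Continuous.intervalIntegrable (by fun_prop) _ _)]
    rw [Real.sq_sqrt hδ.le, mul_regInv_of_le hδ le_rfl]
    simp
  rw [h2]
  simp
  ring_nf
  rw [max_eq_left (by positivity)]

lemma det_clm_prod (A : ℝ × ℝ →L[ℝ] ℝ × ℝ) :
    A.det = (A (1, 0)).1 * (A (0, 1)).2 - (A (0, 1)).1 * (A (1, 0)).2 := by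
  rw [ContinuousLinearMap.det, ← LinearMap.det_toMatrix (Module.Basis.finTwoProd ℝ),
    Matrix.det_fin_two]
  simp [LinearMap.toMatrix_apply]

lemma det_fderiv_prodMk (u v : ℝ × ℝ → ℝ)
    (p : ℝ × ℝ) : ((fderiv ℝ u p).prod (fderiv ℝ v p)).det = jac u v p := by
  rw [det_clm_prod]; rfl

lemma hasStrictFDerivAt_prodMk {u v : ℝ × ℝ → ℝ} (hu : ContDiff ℝ 2 u) (hv : ContDiff ℝ 2 v)
    (p : ℝ × ℝ) :
    HasStrictFDerivAt (fun q => (u q, v q)) ((fderiv ℝ u p).prod (fderiv ℝ v p)) p :=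
  ((hu.contDiffAt.hasStrictFDerivAt (by norm_num))).prodMk
    (hv.contDiffAt.hasStrictFDerivAt (by norm_num))

/-- The derivative of `(u, v)` as an equivalence at a point where the Jacobian is nonzero. -/
lemma exists_equiv_of_jac_ne_zero {u v : ℝ × ℝ → ℝ} (hu : ContDiff ℝ 2 u) (hv : ContDiff ℝ 2 v)
    {p : ℝ × ℝ} (hJ : jac u v p ≠ 0) :
    ∃ e : (ℝ × ℝ) ≃L[ℝ] (ℝ × ℝ), HasStrictFDerivAt (fun q => (u q, v q)) (e : ℝ × ℝ →L[ℝ] ℝ × ℝ) p := by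
  have hd : ((fderiv ℝ u p).prod (fderiv ℝ v p)).det ≠ 0 := by rwa [det_fderiv_prodMk]
  refine ⟨ContinuousLinearMap.toContinuousLinearEquivOfDetNeZero _ hd, ?_⟩
  simpa using hasStrictFDerivAt_prodMk hu hv p

lemma exists_nhds_injOn {u v : ℝ × ℝ → ℝ} (hu : ContDiff ℝ 2 u) (hv : ContDiff ℝ 2 v)
    {z : ℝ × ℝ} (hu0 : u z = 0) (hv0 : v z = 0) (hJ : jac u v z ≠ 0) {O : Set (ℝ × ℝ)}
    (hO : IsOpen O) (hz : z ∈ O) :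
    ∃ V ⊆ O, IsOpen V ∧ z ∈ V ∧ Set.InjOn (fun q => (u q, v q)) V ∧
      (∀ p ∈ V, SignType.sign (jac u v p) = SignType.sign (jac u v z)) ∧
      ∃ δ > 0, {p : ℝ × ℝ | p.1 ^ 2 + p.2 ^ 2 < δ} ⊆ (fun q => (u q, v q)) '' V := by
  obtain ⟨e, he⟩ := exists_equiv_of_jac_ne_zero hu hv hJ
  set Φ := he.toOpenPartialHomeomorph (fun q => (u q, v q)) with hΦ
  have hcoe : (Φ : ℝ × ℝ → ℝ × ℝ) = fun q => (u q, v q) := rfl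
  have hsrc : z ∈ Φ.source := he.mem_toOpenPartialHomeomorph_source
  have hsign : ∃ W : Set (ℝ × ℝ), IsOpen W ∧ z ∈ W ∧
      ∀ p ∈ W, SignType.sign (jac u v p) = SignType.sign (jac u v z) := by
    have hc := continuous_jac hu hv
    rcases lt_or_gt_of_ne hJ with h | h
    · refine ⟨_, isOpen_lt hc continuous_const, h, fun p hp => ?_⟩
      rw [sign_neg h, sign_neg hp]
    · refine ⟨_, isOpen_lt continuous_const hc, h, fun p hp => ?_⟩
      rw [sign_pos h, sign_pos hp]
  obtain ⟨W, hW, hzW, hWs⟩ := hsign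
  refine ⟨O ∩ (Φ.source ∩ W), Set.inter_subset_left, hO.inter (Φ.open_source.inter hW),
    ⟨hz, hsrc, hzW⟩, ?_, fun p hp => hWs p hp.2.2, ?_⟩
  · rw [← hcoe]
    exact Φ.injOn.mono fun p hp => hp.2.1
  · have hopen : IsOpen (Φ '' (O ∩ (Φ.source ∩ W))) :=
      Φ.isOpen_image_of_subset_source (hO.inter (Φ.open_source.inter hW)) fun p hp => hp.2.1
    have h0 : (0, 0) ∈ Φ '' (O ∩ (Φ.source ∩ W)) :=
      ⟨z, ⟨hz, hsrc, hzW⟩, by rw [hcoe]; simp [hu0, hv0]⟩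
    obtain ⟨r, hr, hball⟩ := Metric.isOpen_iff.1 hopen _ h0
    refine ⟨r ^ 2, by positivity, fun p hp => hball ?_⟩
    have hp' : p.1 ^ 2 + p.2 ^ 2 < r ^ 2 := hp
    rw [Metric.mem_ball, Prod.dist_eq, max_lt_iff]
    simp only [Real.dist_eq, sub_zero]
    exact ⟨abs_lt_of_sq_lt_sq (by nlinarith [sq_nonneg p.2]) hr.le,
      abs_lt_of_sq_lt_sq (by nlinarith [sq_nonneg p.1]) hr.le⟩

/-- Change of variables on a sheet of `(u, v)` lying over a disc around the origin. -/
lemma integral_sheet {u v : ℝ × ℝ → ℝ} (hu : ContDiff ℝ 2 u) (hv : ContDiff ℝ 2 v)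
    {V : Set (ℝ × ℝ)} (hV : IsOpen V) (hinj : Set.InjOn (fun q => (u q, v q)) V) {σ : SignType}
    (hσ : ∀ p ∈ V, SignType.sign (jac u v p) = σ) {δ : ℝ}
    (hδ : {p : ℝ × ℝ | p.1 ^ 2 + p.2 ^ 2 < δ} ⊆ (fun q => (u q, v q)) '' V) (k : ℝ → ℝ) :
    ∫ p in V ∩ {p | u p ^ 2 + v p ^ 2 < δ}, k (u p ^ 2 + v p ^ 2) * jac u v p =
      σ * ∫ p in {p : ℝ × ℝ | p.1 ^ 2 + p.2 ^ 2 < δ}, k (p.1 ^ 2 + p.2 ^ 2) := by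
  set U := V ∩ {p | u p ^ 2 + v p ^ 2 < δ} with hU
  have hUm : MeasurableSet U := by
    have h3 := hu.continuous
    have h4 := hv.continuous
    exact (hV.inter (isOpen_lt (by fun_prop) continuous_const)).measurableSet
  have himg : {p : ℝ × ℝ | p.1 ^ 2 + p.2 ^ 2 < δ} = (fun q => (u q, v q)) '' U := by
    ext p
    constructor
    · intro hp
      obtain ⟨q, hq, rfl⟩ := hδ hp
      exact ⟨q, ⟨hq, hp⟩, rfl⟩
    · rintro ⟨q, hq, rfl⟩
      exact hq.2
  rw [himg, MeasureTheory.integral_image_eq_integral_abs_det_fderiv_smul MeasureTheory.volume hUm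
    (fun p _ => (hasStrictFDerivAt_prodMk hu hv p).hasFDerivAt.hasFDerivWithinAt)
    (hinj.mono Set.inter_subset_left), ← MeasureTheory.integral_const_mul]
  apply MeasureTheory.setIntegral_congr_fun hUm
  intro p hp
  have h : (σ : ℝ) * |jac u v p| = jac u v p := by
    rw [← hσ p hp.1]; exact sign_mul_abs _
  simp only [det_fderiv_prodMk, smul_eq_mul]
  linear_combination (-k (u p ^ 2 + v p ^ 2)) * h

/-- The signed number of zeros of a planar map in a rectangle is its winding number along the
boundary. -/
theorem winding_eq_sum_sign {u v : ℝ × ℝ → ℝ} (hu : ContDiff ℝ 2 u) (hv : ContDiff ℝ 2 v)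
    {a b c d : ℝ} (hab : a ≤ b) (hcd : c ≤ d) (Z : Finset (ℝ × ℝ))
    (hZ : ∀ p ∈ Z, p ∈ Set.Ioo a b ×ˢ Set.Ioo c d ∧ u p = 0 ∧ v p = 0 ∧ jac u v p ≠ 0)
    (hZ' : ∀ p ∈ Set.Icc (a, c) (b, d), u p = 0 → v p = 0 → p ∈ Z) :
    (∫ x in a..b, angForm (fun s => 1 / s) u v (1, 0) (x, c)) -
      (∫ x in a..b, angForm (fun s => 1 / s) u v (1, 0) (x, d)) +
      (∫ y in c..d, angForm (fun s => 1 / s) u v (0, 1) (b, y)) -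
      (∫ y in c..d, angForm (fun s => 1 / s) u v (0, 1) (a, y)) =
    2 * Real.pi * ∑ p ∈ Z, (SignType.sign (jac u v p) : ℝ) := by
  have hcu := hu.continuous
  have hcv := hv.continuous
  obtain ⟨O, hO, hOd⟩ := Z.finite_toSet.t2_separation
  have hloc : ∀ z : Z, ∃ V ⊆ O z ∩ Set.Ioo a b ×ˢ Set.Ioo c d, IsOpen V ∧ (z : ℝ × ℝ) ∈ V ∧
      Set.InjOn (fun q => (u q, v q)) V ∧
      (∀ p ∈ V, SignType.sign (jac u v p) = SignType.sign (jac u v z)) ∧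
      ∃ δ > 0, {p : ℝ × ℝ | p.1 ^ 2 + p.2 ^ 2 < δ} ⊆ (fun q => (u q, v q)) '' V := fun z =>
    have h := hZ z z.2
    exists_nhds_injOn hu hv h.2.1 h.2.2.1 h.2.2.2
      ((hO z).2.inter (isOpen_Ioo.prod isOpen_Ioo)) ⟨(hO z).1, h.1⟩
  choose V hVO hVo hzV hVi hVs δ' hδ' hδV using hloc
  have hout : ∃ μ > 0, ∀ p ∈ Set.Icc (a, c) (b, d) \ ⋃ z, V z, μ ≤ u p ^ 2 + v p ^ 2 := by
    have hcomp : IsCompact (Set.Icc (a, c) (b, d) \ ⋃ z, V z) :=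
      isCompact_Icc.diff (isOpen_iUnion hVo)
    rcases Set.eq_empty_or_nonempty (Set.Icc (a, c) (b, d) \ ⋃ z, V z) with h | h
    · exact ⟨1, one_pos, by simp [h]⟩
    · obtain ⟨q, hq, hmin⟩ := hcomp.exists_isMinOn h
        (f := fun p => u p ^ 2 + v p ^ 2) (by fun_prop)
      refine ⟨_, ?_, hmin⟩
      have hq0 : ¬ (u q = 0 ∧ v q = 0) := fun h0 =>
        hq.2 (Set.mem_iUnion.2 ⟨⟨q, hZ' q hq.1 h0.1 h0.2⟩, hzV _⟩)
      have h1 := sq_nonneg (u q)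
      have h2 := sq_nonneg (v q)
      rcases h1.lt_or_eq with h | h
      · positivity
      rcases h2.lt_or_eq with h' | h'
      · positivity
      · exact absurd ⟨pow_eq_zero_iff two_ne_zero |>.1 h.symm,
          pow_eq_zero_iff two_ne_zero |>.1 h'.symm⟩ hq0
  obtain ⟨μ, hμ, hμ'⟩ := hout
  obtain ⟨δ, hδ, hδμ, hδδ⟩ : ∃ δ > 0, δ ≤ μ ∧ ∀ z, δ ≤ δ' z := by
    have h1 : ∀ᶠ δ in nhdsWithin (0 : ℝ) (Set.Ioi 0), δ ≤ μ ∧ ∀ z, δ ≤ δ' z :=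
      Filter.Eventually.filter_mono nhdsWithin_le_nhds
        ((eventually_le_nhds hμ).and (Filter.eventually_all.2 fun z => eventually_le_nhds (hδ' z)))
    obtain ⟨δ, h, h'⟩ := (h1.and self_mem_nhdsWithin).exists
    exact ⟨δ, h', h⟩
  have hbd : ∀ p ∈ Set.Icc (a, c) (b, d), p ∉ Set.Ioo a b ×ˢ Set.Ioo c d →
      ∀ e, angForm (fun s => 1 / s) u v e p = angForm (regInv δ) u v e p := by
    intro p hp hp' e
    have : μ ≤ u p ^ 2 + v p ^ 2 := by
      apply hμ' p ⟨hp, fun h => ?_⟩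
      obtain ⟨z, hz⟩ := Set.mem_iUnion.1 h
      exact hp' (hVO z hz).2
    rw [angForm, angForm, regInv_of_le hδ (hδμ.trans this)]
  have e1 : ∀ y, y = c ∨ y = d → ∫ x in a..b, angForm (fun s => 1 / s) u v (1, 0) (x, y) =
      ∫ x in a..b, angForm (regInv δ) u v (1, 0) (x, y) := by
    intro y hy
    refine intervalIntegral.integral_congr fun x hx => hbd (x, y) ?_ ?_ _
    · rw [Set.uIcc_of_le hab] at hx
      rcases hy with rfl | rfl
      · exact ⟨⟨hx.1, le_rfl⟩, ⟨hx.2, hcd⟩⟩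
      · exact ⟨⟨hx.1, hcd⟩, ⟨hx.2, le_rfl⟩⟩
    · rintro ⟨-, h1, h2⟩
      rcases hy with rfl | rfl
      exacts [lt_irrefl _ h1, lt_irrefl _ h2]
  have e2 : ∀ x, x = a ∨ x = b → ∫ y in c..d, angForm (fun s => 1 / s) u v (0, 1) (x, y) =
      ∫ y in c..d, angForm (regInv δ) u v (0, 1) (x, y) := by
    intro x hx
    refine intervalIntegral.integral_congr fun y hy => hbd (x, y) ?_ ?_ _
    · rw [Set.uIcc_of_le hcd] at hy
      rcases hx with rfl | rfl
      · exact ⟨⟨le_rfl, hy.1⟩, ⟨hab, hy.2⟩⟩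
      · exact ⟨⟨hab, hy.1⟩, ⟨le_rfl, hy.2⟩⟩
    · rintro ⟨⟨h1, h2⟩, -⟩
      rcases hx with rfl | rfl
      exacts [lt_irrefl _ h1, lt_irrefl _ h2]
  rw [e1 c (.inl rfl), e1 d (.inr rfl), e2 a (.inl rfl), e2 b (.inr rfl),
    ← green_angForm (contDiff_regInv hδ) hu hv hab hcd]
  set k : ℝ → ℝ := fun s => 2 * deriv (fun s => s * regInv δ s) s with hk
  have hkc : Continuous k :=
    ((contDiff_id.mul (contDiff_regInv hδ)).continuous_deriv (by norm_num)).const_mul _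
  have hJc := continuous_jac hu hv
  set U : Z → Set (ℝ × ℝ) := fun z => V z ∩ {p | u p ^ 2 + v p ^ 2 < δ} with hU
  have hUR : ∀ z, U z ⊆ Set.Icc (a, c) (b, d) := fun z p hp =>
    have h := (hVO z hp.1).2
    ⟨⟨h.1.1.le, h.2.1.le⟩, ⟨h.1.2.le, h.2.2.le⟩⟩
  have hUm : ∀ z, MeasurableSet (U z) := fun z =>
    ((hVo z).inter (isOpen_lt (by fun_prop) continuous_const)).measurableSet
  have hUd : Pairwise fun z z' => Disjoint (U z) (U z') := fun z z' hzz' =>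
    (hOd z.2 z'.2 fun h => hzz' (Subtype.ext h)).mono (fun p hp => (hVO z hp.1).1)
      fun p hp => (hVO z' hp.1).1
  have hint : MeasureTheory.IntegrableOn (fun p => k (u p ^ 2 + v p ^ 2) * jac u v p)
      (Set.Icc (a, c) (b, d)) := by
    apply ContinuousOn.integrableOn_Icc; fun_prop
  calc ∫ p in Set.Icc (a, c) (b, d), k (u p ^ 2 + v p ^ 2) * jac u v p
      = ∫ p in ⋃ z, U z, k (u p ^ 2 + v p ^ 2) * jac u v p := by
        apply MeasureTheory.setIntegral_eq_of_subset_of_forall_sdiff_eq_zero measurableSet_Icc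
        · exact Set.iUnion_subset hUR
        · rintro p ⟨hp, hp'⟩
          have : δ ≤ u p ^ 2 + v p ^ 2 := by
            by_contra h
            have h' : p ∉ ⋃ z, V z := fun h' => by
              obtain ⟨z, hz⟩ := Set.mem_iUnion.1 h'
              exact hp' (Set.mem_iUnion.2 ⟨z, hz, not_le.1 h⟩)
            exact h (hδμ.trans (hμ' p ⟨hp, h'⟩))
          rw [hk]
          simp only [deriv_mul_regInv_of_le hδ this]
          ring
    _ = ∑ z, ∫ p in U z, k (u p ^ 2 + v p ^ 2) * jac u v p :=
        MeasureTheory.integral_iUnion_fintype hUm hUd fun z => hint.mono_set (hUR z)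
    _ = ∑ z : Z, 2 * Real.pi * (SignType.sign (jac u v z) : ℝ) := by
        refine Finset.sum_congr rfl fun z _ => ?_
        rw [integral_sheet hu hv (hVo z) (hVi z) (hVs z)
          (fun p hp => hδV z (lt_of_lt_of_le hp (hδδ z))) k, hk,
          integral_disc_deriv_regInv hδ, mul_comm]
    _ = _ := by
        rw [Finset.mul_sum, ← Finset.sum_coe_sort Z]

/-- Nondegenerate zeros of a planar map in a compact set are finite in number. -/
lemma finite_zeros {u v : ℝ × ℝ → ℝ} (hu : ContDiff ℝ 2 u) (hv : ContDiff ℝ 2 v)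
    {K : Set (ℝ × ℝ)} (hK : IsCompact K) (hJ : ∀ p ∈ K, u p = 0 → v p = 0 → jac u v p ≠ 0) :
    {p ∈ K | u p = 0 ∧ v p = 0}.Finite := by
  have hcu := hu.continuous
  have hcv := hv.continuous
  have hcl : IsClosed {p | u p = 0 ∧ v p = 0} :=
    (isClosed_eq hcu continuous_const).inter (isClosed_eq hcv continuous_const)
  have hc : IsCompact {p ∈ K | u p = 0 ∧ v p = 0} := hK.inter_right hcl
  refine hc.finite (isDiscrete_iff_forall_mem_exists_isOpen.2 fun z hz => ?_)
  obtain ⟨V, -, hVo, hzV, hVi, -⟩ := exists_nhds_injOn hu hv hz.2.1 hz.2.2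
    (hJ z hz.1 hz.2.1 hz.2.2) isOpen_univ (Set.mem_univ z)
  refine ⟨V, hVo, Set.eq_singleton_iff_unique_mem.2 ⟨⟨hzV, hz⟩, fun p hp => ?_⟩⟩
  exact hVi hp.1 hzV (by simp [hp.2.2.1, hp.2.2.2, hz.2.1, hz.2.2])

lemma fderiv_apply_fst {u : ℝ × ℝ → ℝ} (hu : ContDiff ℝ 2 u) {x y u' : ℝ}
    (h : HasDerivAt (fun t => u (t, y)) u' x) : fderiv ℝ u (x, y) (1, 0) = u' := by
  have h1 : HasFDerivAt u (fderiv ℝ u (x, y)) (x, y) :=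
    (hu.differentiable (by norm_num)).differentiableAt.hasFDerivAt
  exact (h1.comp_hasDerivAt x ((hasDerivAt_id x).prodMk (hasDerivAt_const x y))).unique h

lemma fderiv_apply_snd {u : ℝ × ℝ → ℝ} (hu : ContDiff ℝ 2 u) {x y u' : ℝ}
    (h : HasDerivAt (fun t => u (x, t)) u' y) : fderiv ℝ u (x, y) (0, 1) = u' := by
  have h1 : HasFDerivAt u (fderiv ℝ u (x, y)) (x, y) :=
    (hu.differentiable (by norm_num)).differentiableAt.hasFDerivAt
  exact (h1.comp_hasDerivAt y ((hasDerivAt_const y x).prodMk (hasDerivAt_id y))).unique h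

lemma hasDerivAt_snd {u : ℝ × ℝ → ℝ} (hu : ContDiff ℝ 2 u) (x y : ℝ) :
    HasDerivAt (fun t => u (x, t)) (fderiv ℝ u (x, y) (0, 1)) y :=
  ((hu.differentiable (by norm_num)).differentiableAt.hasFDerivAt).comp_hasDerivAt y
    ((hasDerivAt_const y x).prodMk (hasDerivAt_id y))

lemma boundary_curve_pos {k s c : ℝ} (hk : |k| < 1) (h : s ^ 2 + c ^ 2 = 1) :
    0 < s ^ 2 + (8 * c + 4 * k + 4 * k * c ^ 2) * c := by
  have hs : s ^ 2 = 1 - c ^ 2 := by linarith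
  have h1 : -(|c|) ≤ k * c := by
    have : |k * c| ≤ |c| := by
      rw [abs_mul]; exact mul_le_of_le_one_left (abs_nonneg c) hk.le
    exact (abs_le.1 this).1
  rcases eq_or_ne c 0 with rfl | hc
  · norm_num at h ⊢; rcases h with rfl | rfl <;> norm_num
  have h1' : -(|c|) < k * c := by
    refine lt_of_lt_of_le ?_ (neg_abs_le _)
    rw [abs_mul, neg_lt_neg_iff]
    exact mul_lt_of_lt_one_left (abs_pos.2 hc) hk
  have hc1 : |c| ≤ 1 := abs_le_one_iff_mul_self_le_one.2 (by nlinarith [sq_nonneg s])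
  have hc2 : |c| ^ 2 = c ^ 2 := sq_abs c
  have h2 : 0 ≤ (1 - |c|) * (1 - 3 * |c| + 4 * |c| ^ 2) :=
    mul_nonneg (by linarith) (by nlinarith [sq_nonneg (8 * |c| - 3)])
  have h3 : 0 < (k * c + |c|) * (1 + c ^ 2) := mul_pos (by linarith) (by positivity)
  have h4 : (1 - |c|) * (1 - 3 * |c| + 4 * |c| ^ 2) = 1 - 4 * |c| + 7 * c ^ 2 - 4 * |c| * c ^ 2 := by
    linear_combination (7 - 4 * |c|) * hc2
  have h5 : s ^ 2 + (8 * c + 4 * k + 4 * k * c ^ 2) * c =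
      (1 - 4 * |c| + 7 * c ^ 2 - 4 * |c| * c ^ 2) + 4 * ((k * c + |c|) * (1 + c ^ 2)) := by
    linear_combination hs
  rw [h5, ← h4]
  linarith

lemma boundary_curve_ne_zero {k x : ℝ} (hk : |k| < 1)
    (h1 : Real.sin (4 * x) = 0)
    (h2 : 8 * Real.cos (4 * x) + 4 * k + 4 * k * Real.cos (4 * x) ^ 2 = 0) : False := by
  have := boundary_curve_pos hk (Real.sin_sq_add_cos_sq (4 * x))
  rw [h1, h2] at this
  norm_num at this

lemma integral_boundary {u v : ℝ × ℝ → ℝ} (hu : ContDiff ℝ 2 u) (hv : ContDiff ℝ 2 v)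
    {k l y : ℝ} (hk : |k| < 1) (hl : l ≠ 0) (hU : ∀ x, u (x, y) = l * -Real.sin (4 * x))
    (hV : ∀ x, v (x, y) = l * (8 * Real.cos (4 * x) + 4 * k + 4 * k * Real.cos (4 * x) ^ 2))
    (α : ℝ) :
    ∫ x in α..α + Real.pi, angForm (fun s => 1 / s) u v (1, 0) (x, y) = 4 * Real.pi := by
  have hs : ∀ x : ℝ, HasDerivAt (fun x : ℝ => Real.sin (4 * x)) (Real.cos (4 * x) * 4) x := by
    intro x
    exact ((hasDerivAt_id x).const_mul 4).sin.congr_deriv (by simp)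
  have hc : ∀ x : ℝ, HasDerivAt (fun x : ℝ => Real.cos (4 * x)) (-Real.sin (4 * x) * 4) x := by
    intro x
    exact ((hasDerivAt_id x).const_mul 4).cos.congr_deriv (by simp)
  have hy : ∀ x : ℝ, HasDerivAt
      (fun x : ℝ => 8 * Real.cos (4 * x) + 4 * k + 4 * k * Real.cos (4 * x) ^ 2)
      (-32 * Real.sin (4 * x) * (1 + k * Real.cos (4 * x))) x := by
    intro x
    refine ((((hc x).const_mul 8).add_const (4 * k)).add
      (((hc x).pow 2).const_mul (4 * k))).congr_deriv ?_
    push_cast; ring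
  set Y : ℝ → ℝ := fun x => 8 * Real.cos (4 * x) + 4 * k + 4 * k * Real.cos (4 * x) ^ 2 with hY
  set P : ℝ → ℝ := fun x => Real.sin (4 * x) ^ 2 + Y x * Real.cos (4 * x) with hP
  set Q : ℝ → ℝ := fun x => Real.sin (4 * x) * Real.cos (4 * x) - Y x * Real.sin (4 * x) with hQ
  have hPpos : ∀ x, 0 < P x := fun x => boundary_curve_pos hk (Real.sin_sq_add_cos_sq (4 * x))
  have hval : ∀ x, angForm (fun s => 1 / s) u v (1, 0) (x, y) =
      1 / ((l * -Real.sin (4 * x)) ^ 2 + (l * Y x) ^ 2) *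
        (l * -Real.sin (4 * x) * (l * (-32 * Real.sin (4 * x) * (1 + k * Real.cos (4 * x)))) -
          l * Y x * (l * -(Real.cos (4 * x) * 4))) := by
    intro x
    have h1 : HasDerivAt (fun t => u (t, y)) (l * -(Real.cos (4 * x) * 4)) x := by
      simp_rw [hU]; exact (hs x).neg.const_mul l
    have h2 : HasDerivAt (fun t => v (t, y))
        (l * (-32 * Real.sin (4 * x) * (1 + k * Real.cos (4 * x)))) x := by
      simp_rw [hV]; exact (hy x).const_mul l
    rw [angForm, fderiv_apply_fst hu h1, fderiv_apply_fst hv h2, hU, hV]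
  have hder : ∀ x ∈ Set.uIcc α (α + Real.pi), HasDerivAt
      (fun x => 4 * x + Real.arctan (Q x / P x))
      (angForm (fun s => 1 / s) u v (1, 0) (x, y)) x := by
    intro x _
    have hP' : HasDerivAt P _ x := ((hs x).pow 2).add ((hy x).mul (hc x))
    have hQ' : HasDerivAt Q _ x := ((hs x).mul (hc x)).sub ((hy x).mul (hs x))
    have hsc := Real.sin_sq_add_cos_sq (4 * x)
    have hR : P x ^ 2 + Q x ^ 2 = Real.sin (4 * x) ^ 2 + Y x ^ 2 := by
      simp only [hP, hQ]
      linear_combination (Real.sin (4 * x) ^ 2 + Y x ^ 2) * hsc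
    have hP0 := (hPpos x).ne'
    have hR0 : P x ^ 2 + Q x ^ 2 ≠ 0 := by have := hPpos x; positivity
    refine (((hasDerivAt_id x).const_mul 4).add ((hQ'.div hP' hP0).arctan)).congr_deriv ?_
    have hquot : ∀ a b : ℝ, 1 / (1 + (Q x / P x) ^ 2) * ((a * P x - Q x * b) / P x ^ 2) =
        (a * P x - Q x * b) / (P x ^ 2 + Q x ^ 2) := by
      intro a b
      have : 1 + (Q x / P x) ^ 2 = (P x ^ 2 + Q x ^ 2) / P x ^ 2 := by field_simp
      rw [this]
      field_simp
    have hden : (l * -Real.sin (4 * x)) ^ 2 + (l * Y x) ^ 2 =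
        l ^ 2 * (P x ^ 2 + Q x ^ 2) := by rw [hR]; ring
    rw [hval x, Pi.div_apply, hquot, hden]
    have hl2 : l ^ 2 * (P x ^ 2 + Q x ^ 2) ≠ 0 := mul_ne_zero (pow_ne_zero 2 hl) hR0
    rw [one_div_mul_eq_div, eq_div_iff hl2, mul_comm (l ^ 2), ← mul_assoc, add_mul,
      div_mul_cancel₀ _ hR0]
    simp only [hP, hQ]
    generalize Y x = w
    generalize Real.sin (4 * x) = s at *
    generalize Real.cos (4 * x) = c at *
    push_cast
    linear_combination (l ^ 2 * (32 * s ^ 2 * (1 + k * c) + 4 * w * c)) * hsc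
  have hper : ∀ x, Real.sin (4 * (x + Real.pi)) = Real.sin (4 * x) ∧
      Real.cos (4 * (x + Real.pi)) = Real.cos (4 * x) := by
    intro x
    have : 4 * (x + Real.pi) = 4 * x + (2 : ℕ) * (2 * Real.pi) := by push_cast; ring
    rw [this]
    exact ⟨Real.sin_add_nat_mul_two_pi _ _, Real.cos_add_nat_mul_two_pi _ _⟩
  rw [intervalIntegral.integral_eq_sub_of_hasDerivAt hder]
  · simp only [hP, hQ, hY, (hper α).1, (hper α).2]
    ring
  · apply Continuous.intervalIntegrable
    simp_rw [hval]
    have hYc : Continuous Y := by fun_prop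
    refine Continuous.mul (continuous_const.div (by fun_prop) fun x => ?_) (by fun_prop)
    intro h0
    have hb : l * -Real.sin (4 * x) = 0 ∧ l * Y x = 0 := by
      constructor <;> nlinarith [sq_nonneg (l * -Real.sin (4 * x)), sq_nonneg (l * Y x)]
    have h1 := (mul_eq_zero.1 hb.1).resolve_left hl
    have h2 := (mul_eq_zero.1 hb.2).resolve_left hl
    exact boundary_curve_ne_zero hk (neg_eq_zero.1 h1) h2

/-- Signed count of zeros for a section over a closed Möbius band, given by a twisted periodic pair
of functions on a strip, with prescribed behaviour on the boundary. -/
theorem sum_sign_moebius {u v : ℝ × ℝ → ℝ} (hu : ContDiff ℝ 2 u) (hv : ContDiff ℝ 2 v)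
    (hut : ∀ x y, u (x + Real.pi, y) = -u (x, -y)) (hvt : ∀ x y, v (x + Real.pi, y) = v (x, -y))
    {k l : ℝ} (hk : |k| < 1) (hl : l ≠ 0)
    (hU : ∀ x, u (x, Real.pi / 2) = l * -Real.sin (4 * x))
    (hV : ∀ x, v (x, Real.pi / 2) =
      l * (8 * Real.cos (4 * x) + 4 * k + 4 * k * Real.cos (4 * x) ^ 2))
    (α : ℝ) (Z : Finset (ℝ × ℝ))
    (hZ : ∀ p ∈ Z, p ∈ Set.Ioo α (α + Real.pi) ×ˢ Set.Ioo (-(Real.pi / 2)) (Real.pi / 2) ∧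
      u p = 0 ∧ v p = 0 ∧ jac u v p ≠ 0)
    (hZ' : ∀ p ∈ Set.Icc (α, -(Real.pi / 2)) (α + Real.pi, Real.pi / 2),
      u p = 0 → v p = 0 → p ∈ Z) :
    ∑ p ∈ Z, (SignType.sign (jac u v p) : ℝ) = -4 := by
  have hpi := Real.pi_pos
  have main := winding_eq_sum_sign hu hv (by linarith) (by linarith) Z hZ hZ'
  have hside : ∫ y in -(Real.pi / 2)..Real.pi / 2,
        angForm (fun s => 1 / s) u v (0, 1) (α + Real.pi, y) =
      ∫ y in -(Real.pi / 2)..Real.pi / 2, angForm (fun s => 1 / s) u v (0, 1) (α, y) := by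
    have : ∀ y, angForm (fun s => 1 / s) u v (0, 1) (α + Real.pi, y) =
        angForm (fun s => 1 / s) u v (0, 1) (α, -y) := by
      intro y
      have h1 : HasDerivAt (fun t => u (α + Real.pi, t)) (fderiv ℝ u (α, -y) (0, 1)) y := by
        simp_rw [hut]
        exact (HasDerivAt.comp y (hasDerivAt_snd hu α (-y)) (hasDerivAt_neg y)).neg.congr_deriv
          (by ring)
      have h2 : HasDerivAt (fun t => v (α + Real.pi, t)) (-fderiv ℝ v (α, -y) (0, 1)) y := by
        simp_rw [hvt]
        exact (HasDerivAt.comp y (hasDerivAt_snd hv α (-y)) (hasDerivAt_neg y)).congr_deriv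
          (by ring)
      rw [angForm, angForm, fderiv_apply_snd hu h1, fderiv_apply_snd hv h2, hut, hvt]
      ring_nf
    simp_rw [this]
    rw [intervalIntegral.integral_comp_neg (f := fun y => angForm (fun s => 1 / s) u v (0, 1) (α, y)),
      neg_neg]
  have hper : ∀ x, Real.sin (4 * (x - Real.pi)) = Real.sin (4 * x) ∧
      Real.cos (4 * (x - Real.pi)) = Real.cos (4 * x) := by
    intro x
    have : 4 * (x - Real.pi) = 4 * x - (2 : ℕ) * (2 * Real.pi) := by push_cast; ring
    rw [this]
    exact ⟨Real.sin_sub_nat_mul_two_pi _ _, Real.cos_sub_nat_mul_two_pi _ _⟩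
  have hbot : ∀ x, u (x, -(Real.pi / 2)) = -u (x, Real.pi / 2) ∧
      v (x, -(Real.pi / 2)) = v (x, Real.pi / 2) := by
    intro x
    have h1 := hut (x - Real.pi) (-(Real.pi / 2))
    have h2 := hvt (x - Real.pi) (-(Real.pi / 2))
    rw [sub_add_cancel, neg_neg] at h1 h2
    rw [h1, h2, hU, hV, hU, hV, (hper x).1, (hper x).2]
    exact ⟨rfl, rfl⟩
  have hbot' : ∀ x, angForm (fun s => 1 / s) u v (1, 0) (x, -(Real.pi / 2)) =
      -angForm (fun s => 1 / s) u v (1, 0) (x, Real.pi / 2) := by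
    intro x
    have hfst : ∀ {w : ℝ × ℝ → ℝ}, ContDiff ℝ 2 w → ∀ y, HasDerivAt (fun t => w (t, y))
        (fderiv ℝ w (x, y) (1, 0)) x := fun hw y =>
      ((hw.differentiable (by norm_num)).differentiableAt.hasFDerivAt).comp_hasDerivAt x
        ((hasDerivAt_id x).prodMk (hasDerivAt_const x y))
    have h1 : HasDerivAt (fun t => u (t, -(Real.pi / 2)))
        (-fderiv ℝ u (x, Real.pi / 2) (1, 0)) x := by
      simp_rw [fun x => (hbot x).1]; exact (hfst hu _).neg
    have h2 : HasDerivAt (fun t => v (t, -(Real.pi / 2)))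
        (fderiv ℝ v (x, Real.pi / 2) (1, 0)) x := by
      simp_rw [fun x => (hbot x).2]; exact hfst hv _
    rw [angForm, angForm, fderiv_apply_fst hu h1, fderiv_apply_fst hv h2, (hbot x).1, (hbot x).2]
    ring_nf
  simp_rw [hbot'] at main
  rw [hside, intervalIntegral.integral_neg, integral_boundary hu hv hk hl hU hV α] at main
  have : 2 * Real.pi * (∑ p ∈ Z, (SignType.sign (jac u v p) : ℝ) + 4) = 0 := by linarith
  have h2 := (mul_eq_zero.1 this).resolve_left (by positivity)
  linarith

/-! ### Restriction of a polynomial to a parametrized line -/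

/-- The polynomial `t ↦ f (A + t B)`. -/
def lineRestrict (A B : Fin 3 → ℝ) : MvPolynomial (Fin 3) ℝ →ₐ[ℝ] Polynomial ℝ :=
  aeval fun j => Polynomial.C (A j) + Polynomial.C (B j) * Polynomial.X

/-- The directional derivative of `f` along `v`, as a polynomial. -/
def dirDeriv (v : Fin 3 → ℝ) (f : MvPolynomial (Fin 3) ℝ) : MvPolynomial (Fin 3) ℝ :=
  ∑ j, C (v j) * pderiv j f

lemma cev_eq_aeval (f : MvPolynomial (Fin 3) ℝ) (p : Fin 3 → ℂ) : cev f p = aeval p f := by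
  rw [cev, cmap, eval_map, aeval_def]

lemma cev_cvec (f : MvPolynomial (Fin 3) ℝ) (p : Fin 3 → ℝ) :
    cev f (cvec p) = (eval p f : ℝ) := by
  rw [cev, cmap, eval_map]
  exact (eval₂_comp (algebraMap ℝ ℂ) p f).symm

lemma cev_dirDeriv (v : Fin 3 → ℝ) (f : MvPolynomial (Fin 3) ℝ) (p : Fin 3 → ℂ) :
    cev (dirDeriv v f) p = Dv f v p := by
  simp only [cev, dirDeriv, Dv, cmap, map_sum, map_mul, map_C, eval_C, pderiv_map]
  rfl

lemma isHomogeneous_dirDeriv {f : MvPolynomial (Fin 3) ℝ} {n : ℕ} (hf : f.IsHomogeneous n)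
    (v : Fin 3 → ℝ) : (dirDeriv v f).IsHomogeneous (n - 1) :=
  IsHomogeneous.sum _ _ _ fun j _ => by
    simpa using (isHomogeneous_C _ (v j)).mul (hf.pderiv (i := j))

lemma aeval_lineRestrict (f : MvPolynomial (Fin 3) ℝ) (A B : Fin 3 → ℝ) (t : ℂ) :
    Polynomial.aeval t (lineRestrict A B f) = cev f (cvec A + t • cvec B) := by
  rw [cev_eq_aeval, lineRestrict, ← AlgHom.comp_apply]
  congr 1
  ext j : 1
  rw [AlgHom.comp_apply, aeval_X, aeval_X]
  simp only [map_add, map_mul, Polynomial.aeval_C, Polynomial.aeval_X, Pi.add_apply, Pi.smul_apply,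
    smul_eq_mul, cvec, Complex.coe_algebraMap]
  ring

lemma sum_eq_of_mem_support {f : MvPolynomial (Fin 3) ℝ} {n : ℕ} (hf : f.IsHomogeneous n)
    {m : Fin 3 →₀ ℕ} (hm : m ∈ f.support) : ∑ j, m j = n := by
  have := hf (mem_support_iff.1 hm)
  rw [Finsupp.weight_apply, Finsupp.sum_fintype _ _ (by simp)] at this
  simpa using this

lemma cev_smul {f : MvPolynomial (Fin 3) ℝ} {n : ℕ} (hf : f.IsHomogeneous n) (c : ℂ)
    (p : Fin 3 → ℂ) : cev f (c • p) = c ^ n * cev f p := by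
  rw [cev_eq_aeval, cev_eq_aeval, aeval_def, aeval_def, eval₂_eq', eval₂_eq', Finset.mul_sum]
  refine Finset.sum_congr rfl fun m hm => ?_
  simp only [Pi.smul_apply, smul_eq_mul, mul_pow, Finset.prod_mul_distrib,
    Finset.prod_pow_eq_pow_sum, sum_eq_of_mem_support hf hm]
  ring

lemma natDegree_lineRestrict_le {f : MvPolynomial (Fin 3) ℝ} {n : ℕ} (hf : f.IsHomogeneous n)
    (A B : Fin 3 → ℝ) : (lineRestrict A B f).natDegree ≤ n := by
  rw [lineRestrict, aeval_def, eval₂_eq']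
  refine Polynomial.natDegree_sum_le_of_forall_le _ _ fun m hm => ?_
  refine (Polynomial.natDegree_C_mul_le _ _).trans ((Polynomial.natDegree_prod_le _ _).trans ?_)
  rw [← sum_eq_of_mem_support hf hm]
  refine Finset.sum_le_sum fun j _ => ?_
  refine Polynomial.natDegree_pow_le.trans ?_
  refine (Nat.mul_le_mul_left _ (m := 1) ?_).trans (mul_one _).le
  compute_degree

/-- The binary form obtained by restricting a quartic to the plane spanned by `A` and `B`. -/
lemma cev_add_smul {f : MvPolynomial (Fin 3) ℝ} (hf : f.IsHomogeneous 4)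
    (A B : Fin 3 → ℝ) (x y : ℂ) :
    cev f (x • cvec A + y • cvec B) =
      (lineRestrict A B f).coeff 0 * x ^ 4 + (lineRestrict A B f).coeff 1 * x ^ 3 * y +
      (lineRestrict A B f).coeff 2 * x ^ 2 * y ^ 2 + (lineRestrict A B f).coeff 3 * x * y ^ 3 +
      (lineRestrict A B f).coeff 4 * y ^ 4 := by
  revert x
  refine congrFun (Continuous.ext_on (dense_compl_singleton (0 : ℂ)) ?_ (by fun_prop) ?_)
  · exact (MvPolynomial.continuous_eval (cmap f)).comp (by fun_prop)
  · intro x hx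
    have hx : x ≠ 0 := hx
    have h1 : x • cvec A + y • cvec B = x • (cvec A + (y / x) • cvec B) := by
      rw [smul_add, smul_smul, mul_div_cancel₀ _ hx]
    simp only []
    rw [h1, cev_smul hf, ← aeval_lineRestrict,
      Polynomial.aeval_eq_sum_range' (Nat.lt_succ_of_le (natDegree_lineRestrict_le hf A B))]
    simp only [Finset.sum_range_succ, Finset.sum_range_zero, Complex.real_smul]
    field_simp
    ring

lemma coeff_lineRestrict_four {f : MvPolynomial (Fin 3) ℝ} (hf : f.IsHomogeneous 4)
    (A B : Fin 3 → ℝ) : (lineRestrict A B f).coeff 4 = eval B f := by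
  have := cev_add_smul hf A B 0 1
  simp only [zero_smul, one_smul, zero_add, cev_cvec] at this
  norm_num at this
  exact_mod_cast this.symm

lemma dirDeriv_add (v : Fin 3 → ℝ) (p q : MvPolynomial (Fin 3) ℝ) :
    dirDeriv v (p + q) = dirDeriv v p + dirDeriv v q := by
  simp only [dirDeriv, map_add, mul_add, Finset.sum_add_distrib]

lemma dirDeriv_mul_X (v : Fin 3 → ℝ) (p : MvPolynomial (Fin 3) ℝ) (j : Fin 3) :
    dirDeriv v (p * X j) = dirDeriv v p * X j + p * C (v j) := by
  simp only [dirDeriv, Derivation.leibniz, pderiv_X, Pi.single_apply, smul_eq_mul, mul_add,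
    Finset.sum_add_distrib, Finset.sum_mul]
  rw [add_comm]
  congr 1
  · exact Finset.sum_congr rfl fun i _ => by ring
  · simp [mul_comm]

/-- Restricting the derivative along the line's direction gives the derivative of the
restriction. -/
lemma lineRestrict_dirDeriv_right (f : MvPolynomial (Fin 3) ℝ) (A B : Fin 3 → ℝ) :
    lineRestrict A B (dirDeriv B f) = Polynomial.derivative (lineRestrict A B f) := by
  induction f using MvPolynomial.induction_on with
  | C a => simp [dirDeriv, lineRestrict]
  | add p q hp hq =>
    rw [dirDeriv_add, map_add, map_add, map_add, hp, hq]
  | mul_X p j hp =>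
    rw [dirDeriv_mul_X, map_add, map_mul, map_mul, hp]
    simp [lineRestrict]

/-- Euler's identity on a line. -/
lemma lineRestrict_dirDeriv_left {f : MvPolynomial (Fin 3) ℝ} {n : ℕ} (hf : f.IsHomogeneous n)
    (A B : Fin 3 → ℝ) :
    lineRestrict A B (dirDeriv A f) = (n : Polynomial ℝ) * lineRestrict A B f -
      Polynomial.X * Polynomial.derivative (lineRestrict A B f) := by
  have h := congrArg (lineRestrict A B) hf.sum_X_mul_pderiv
  rw [← lineRestrict_dirDeriv_right, eq_sub_iff_add_eq]
  simp only [nsmul_eq_mul, map_mul, map_natCast] at h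
  rw [← h]
  simp only [dirDeriv, map_sum, map_mul, Finset.mul_sum, ← Finset.sum_add_distrib]
  refine Finset.sum_congr rfl fun j _ => ?_
  simp [lineRestrict]
  ring

lemma lineRestrict_dirDeriv_add_smul (f : MvPolynomial (Fin 3) ℝ) (A B v w : Fin 3 → ℝ) (a b : ℝ) :
    lineRestrict A B (dirDeriv (a • v + b • w) f) =
      Polynomial.C a * lineRestrict A B (dirDeriv v f) +
      Polynomial.C b * lineRestrict A B (dirDeriv w f) := by
  simp only [dirDeriv, map_sum, map_mul, Finset.mul_sum, ← Finset.sum_add_distrib]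
  refine Finset.sum_congr rfl fun j _ => ?_
  simp [lineRestrict]
  ring

lemma contDiff_coeff_lineRestrict {E : Type*} [NormedAddCommGroup E] [NormedSpace ℝ E]
    {A B : E → Fin 3 → ℝ} {n : WithTop ℕ∞} (hA : ContDiff ℝ n A) (hB : ContDiff ℝ n B)
    (f : MvPolynomial (Fin 3) ℝ) (i : ℕ) :
    ContDiff ℝ n fun p => (lineRestrict (A p) (B p) f).coeff i := by
  induction f using MvPolynomial.induction_on generalizing i with
  | C a => simpa [lineRestrict] using contDiff_const
  | add p q hp hq => simpa using (hp i).add (hq i)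
  | mul_X p j hp =>
    have hAj : ContDiff ℝ n fun x => A x j := contDiff_pi.1 hA j
    have hBj : ContDiff ℝ n fun x => B x j := contDiff_pi.1 hB j
    rcases i with _ | i
    · have : ∀ x, (lineRestrict (A x) (B x) (p * X j)).coeff 0 =
          (lineRestrict (A x) (B x) p).coeff 0 * A x j := by
        intro x; simp [lineRestrict, mul_add, Polynomial.mul_coeff_zero]
      simp_rw [this]
      exact (hp 0).mul hAj
    · have : ∀ x, (lineRestrict (A x) (B x) (p * X j)).coeff (i + 1) =
          (lineRestrict (A x) (B x) p).coeff (i + 1) * A x j +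
          (lineRestrict (A x) (B x) p).coeff i * B x j := by
        intro x
        simp [lineRestrict, mul_add, ← mul_assoc, Polynomial.coeff_mul_X]
      simp_rw [this]
      exact ((hp _).mul hAj).add ((hp _).mul hBj)

/-- Derivative of the coefficients of the restriction of `f` to a moving line. -/
lemma hasDerivAt_coeff_lineRestrict {A B : ℝ → Fin 3 → ℝ} {A' B' : Fin 3 → ℝ} {x : ℝ}
    (hA : HasDerivAt A A' x) (hB : HasDerivAt B B' x) (f : MvPolynomial (Fin 3) ℝ) (i : ℕ) :
    HasDerivAt (fun t => (lineRestrict (A t) (B t) f).coeff i)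
      ((lineRestrict (A x) (B x) (dirDeriv A' f) +
        Polynomial.X * lineRestrict (A x) (B x) (dirDeriv B' f)).coeff i) x := by
  induction f using MvPolynomial.induction_on generalizing i with
  | C a => simpa [lineRestrict, dirDeriv] using hasDerivAt_const _ _
  | add p q hp hq =>
    simp only [dirDeriv_add, map_add, Polynomial.coeff_add]
    refine ((hp i).add (hq i)).congr_deriv ?_
    simp only [mul_add, Polynomial.coeff_add]
    ring
  | mul_X p j hp =>
    have hAj := hasDerivAt_pi.1 hA j
    have hBj := hasDerivAt_pi.1 hB j
    have hX : ∀ x, lineRestrict (A x) (B x) (X j) =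
        Polynomial.C (A x j) + Polynomial.C (B x j) * Polynomial.X := fun x => by simp [lineRestrict]
    have hC : ∀ x c, lineRestrict (A x) (B x) (C c) = Polynomial.C c := fun x c => by
      simp [lineRestrict]
    simp only [dirDeriv_mul_X, map_add, map_mul, hX, hC]
    rcases i with _ | i
    · have : ∀ t, (lineRestrict (A t) (B t) p *
          (Polynomial.C (A t j) + Polynomial.C (B t j) * Polynomial.X)).coeff 0 =
          (lineRestrict (A t) (B t) p).coeff 0 * A t j := by
        intro t; simp [mul_add, Polynomial.mul_coeff_zero]
      simp_rw [this]
      refine ((hp 0).mul hAj).congr_deriv ?_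
      simp [Polynomial.mul_coeff_zero]
    · have : ∀ t, (lineRestrict (A t) (B t) p *
          (Polynomial.C (A t j) + Polynomial.C (B t j) * Polynomial.X)).coeff (i + 1) =
          (lineRestrict (A t) (B t) p).coeff (i + 1) * A t j +
          (lineRestrict (A t) (B t) p).coeff i * B t j := by
        intro t; simp [mul_add, ← mul_assoc, Polynomial.coeff_mul_X]
      simp_rw [this]
      refine (((hp _).mul hAj).add ((hp _).mul hBj)).congr_deriv ?_
      rcases i with _ | i
      · simp [mul_add, add_mul, ← mul_assoc, Polynomial.coeff_mul_X, Polynomial.coeff_X_mul]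
        ring
      · simp [mul_add, add_mul, ← mul_assoc, Polynomial.coeff_mul_X, Polynomial.coeff_X_mul]
        ring

/-! ### Binary quartics without real zeros -/

lemma exists_quadratic_factor {c₀ c₁ c₂ c₃ c₄ : ℝ}
    (h : ∀ x y : ℝ, c₀ * x ^ 4 + c₁ * x ^ 3 * y + c₂ * x ^ 2 * y ^ 2 + c₃ * x * y ^ 3 + c₄ * y ^ 4 = 0 →
      x = 0 ∧ y = 0) :
    ∃ a b A B C : ℝ, b ≠ 0 ∧ ∀ x y : ℝ,
      c₀ * x ^ 4 + c₁ * x ^ 3 * y + c₂ * x ^ 2 * y ^ 2 + c₃ * x * y ^ 3 + c₄ * y ^ 4 =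
        ((y - a * x) ^ 2 + b ^ 2 * x ^ 2) * (A * y ^ 2 + B * x * y + C * x ^ 2) := by
  have h4 : c₄ ≠ 0 := by
    rintro rfl
    exact one_ne_zero (h 0 1 (by ring)).2
  obtain ⟨z, hz⟩ : ∃ z : ℂ, (c₀ + c₁ * z + c₂ * z ^ 2 + c₃ * z ^ 3 + c₄ * z ^ 4 : ℂ) = 0 := by
    let p : Polynomial ℂ := Polynomial.C (c₄ : ℂ) * Polynomial.X ^ 4 +
      Polynomial.C (c₃ : ℂ) * Polynomial.X ^ 3 + Polynomial.C (c₂ : ℂ) * Polynomial.X ^ 2 +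
      Polynomial.C (c₁ : ℂ) * Polynomial.X + Polynomial.C (c₀ : ℂ)
    have hp : p.degree = 4 := by
      have : (c₄ : ℂ) ≠ 0 := by exact_mod_cast h4
      simp only [p]
      compute_degree!
    obtain ⟨z, hz⟩ := IsAlgClosed.exists_root p (by rw [hp]; norm_num)
    refine ⟨z, ?_⟩
    simp only [p, Polynomial.IsRoot, Polynomial.eval_add, Polynomial.eval_mul, Polynomial.eval_C,
      Polynomial.eval_pow, Polynomial.eval_X] at hz
    linear_combination hz
  obtain ⟨a, b⟩ := z
  have hb : b ≠ 0 := by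
    rintro rfl
    have hza : (⟨a, 0⟩ : ℂ) = (a : ℂ) := rfl
    rw [hza] at hz
    have : c₀ + c₁ * a + c₂ * a ^ 2 + c₃ * a ^ 3 + c₄ * a ^ 4 = 0 := by exact_mod_cast hz
    exact one_ne_zero (h 1 a (by linear_combination this)).1
  set z : ℂ := ⟨a, b⟩ with hzdef
  have hq : z ^ 2 = 2 * a * z - (a ^ 2 + b ^ 2) := by
    apply Complex.ext <;> simp [hzdef, pow_two] <;> ring
  set B := c₃ + 2 * a * c₄ with hB
  set C := c₂ + 2 * a * B - (a ^ 2 + b ^ 2) * c₄ with hC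
  have hrem : ((c₁ + 2 * a * C - (a ^ 2 + b ^ 2) * B : ℝ) : ℂ) * z +
      ((c₀ - (a ^ 2 + b ^ 2) * C : ℝ) : ℂ) = 0 := by
    simp only [hC, hB]
    push_cast
    linear_combination hz - ((c₂ + 2 * a * (c₃ + 2 * a * c₄) - (a ^ 2 + b ^ 2) * c₄ : ℂ) +
      (c₃ + 2 * a * c₄) * z + c₄ * z ^ 2) * hq
  have him := congrArg Complex.im hrem
  simp only [Complex.add_im, Complex.im_ofReal_mul, Complex.ofReal_im, add_zero, Complex.zero_im] at him
  have h1 := (mul_eq_zero.1 him).resolve_right hb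
  rw [h1] at hrem
  have h0 : c₀ - (a ^ 2 + b ^ 2) * C = 0 := by
    simpa only [Complex.ofReal_zero, zero_mul, zero_add, Complex.ofReal_eq_zero] using hrem
  refine ⟨a, b, c₄, B, C, hb, fun x y => ?_⟩
  linear_combination x ^ 4 * h0 + x ^ 3 * y * h1 + x ^ 2 * y ^ 2 * hC.symm + x * y ^ 3 * hB.symm

lemma exists_rotation (A B C : ℝ) : ∃ s c : ℝ, s ^ 2 + c ^ 2 = 1 ∧
    2 * (A - C) * s * c + B * (c ^ 2 - s ^ 2) = 0 := by
  set z : ℂ := ⟨A - C, -B⟩ with hz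
  have h1 : ‖z‖ * Real.cos z.arg = A - C := Complex.norm_mul_cos_arg z
  have h2 : ‖z‖ * Real.sin z.arg = -B := Complex.norm_mul_sin_arg z
  set t := z.arg / 2 with ht
  have h3 : z.arg = 2 * t := by rw [ht]; ring
  rw [h3, Real.cos_two_mul'] at h1
  rw [h3, Real.sin_two_mul] at h2
  refine ⟨Real.sin t, Real.cos t, Real.sin_sq_add_cos_sq t, ?_⟩
  rw [← h1, ← neg_eq_iff_eq_neg.2 h2]
  ring

/-- A real binary quartic without real zeros is equivalent, up to a scalar, to
`(x ^ 2 + y ^ 2) ^ 2 + k * Re ((x + y * I) ^ 4)` with `|k| < 1`. -/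
lemma exists_binary_normal_form {c₀ c₁ c₂ c₃ c₄ : ℝ}
    (h : ∀ x y : ℝ, c₀ * x ^ 4 + c₁ * x ^ 3 * y + c₂ * x ^ 2 * y ^ 2 + c₃ * x * y ^ 3 + c₄ * y ^ 4 = 0 →
      x = 0 ∧ y = 0) :
    ∃ p q r s σ k : ℝ, p * s - q * r ≠ 0 ∧ σ ≠ 0 ∧ |k| < 1 ∧ ∀ x y : ℝ,
      σ * (c₀ * (p * x + q * y) ^ 4 + c₁ * (p * x + q * y) ^ 3 * (r * x + s * y) +
        c₂ * (p * x + q * y) ^ 2 * (r * x + s * y) ^ 2 +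
        c₃ * (p * x + q * y) * (r * x + s * y) ^ 3 + c₄ * (r * x + s * y) ^ 4) =
      (x ^ 2 + y ^ 2) ^ 2 + k * (x ^ 4 - 6 * x ^ 2 * y ^ 2 + y ^ 4) := by
  obtain ⟨a, b, A, B, C, hb, hfac⟩ := exists_quadratic_factor h
  simp only [hfac] at h ⊢
  obtain ⟨s, c, hsc, hrot⟩ := exists_rotation (A * b ^ 2) (2 * A * a * b + B * b)
    (A * a ^ 2 + B * a + C)
  set α := A * b ^ 2 * s ^ 2 + (2 * A * a * b + B * b) * s * c + (A * a ^ 2 + B * a + C) * c ^ 2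
    with hα
  set β := A * b ^ 2 * c ^ 2 - (2 * A * a * b + B * b) * s * c + (A * a ^ 2 + B * a + C) * s ^ 2
    with hβ
  have hdiag : ∀ x y : ℝ,
      (((a * (c * x - s * y) + b * (s * x + c * y)) - a * (c * x - s * y)) ^ 2 +
        b ^ 2 * (c * x - s * y) ^ 2) *
      (A * (a * (c * x - s * y) + b * (s * x + c * y)) ^ 2 +
        B * (c * x - s * y) * (a * (c * x - s * y) + b * (s * x + c * y)) +
        C * (c * x - s * y) ^ 2) = b ^ 2 * ((x ^ 2 + y ^ 2) * (α * x ^ 2 + β * y ^ 2)) := by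
    intro x y
    have e1 : ((a * (c * x - s * y) + b * (s * x + c * y)) - a * (c * x - s * y)) ^ 2 +
        b ^ 2 * (c * x - s * y) ^ 2 = b ^ 2 * (x ^ 2 + y ^ 2) := by
      linear_combination b ^ 2 * (x ^ 2 + y ^ 2) * hsc
    have e2 : A * (a * (c * x - s * y) + b * (s * x + c * y)) ^ 2 +
        B * (c * x - s * y) * (a * (c * x - s * y) + b * (s * x + c * y)) +
        C * (c * x - s * y) ^ 2 = α * x ^ 2 + β * y ^ 2 := by
      linear_combination x * y * hrot
    rw [e1, e2, mul_assoc]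
  have hne : ∀ x y : ℝ, (x ^ 2 + y ^ 2) * (α * x ^ 2 + β * y ^ 2) = 0 → x = 0 ∧ y = 0 := by
    intro x y h0
    obtain ⟨h1, h2⟩ := h (c * x - s * y) (a * (c * x - s * y) + b * (s * x + c * y))
      (by rw [hdiag, h0, mul_zero])
    rw [h1, mul_zero, zero_add] at h2
    have h2 := (mul_eq_zero.1 h2).resolve_left hb
    constructor
    · linear_combination c * h1 + s * h2 - x * hsc
    · linear_combination -s * h1 + c * h2 - y * hsc
  have hα0 : α ≠ 0 := fun h0 => one_ne_zero (hne 1 0 (by rw [h0]; ring)).1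
  have hβ0 : β ≠ 0 := fun h0 => one_ne_zero (hne 0 1 (by rw [h0]; ring)).2
  have hpos : 0 < β / α := by
    by_contra hneg
    have hsq : Real.sqrt (-(β / α)) ^ 2 = -(β / α) := Real.sq_sqrt (by linarith)
    refine one_ne_zero (hne (Real.sqrt (-(β / α))) 1 ?_).2
    rw [hsq]
    field_simp
    ring
  set m := Real.sqrt (β / α) with hm
  have hm0 : 0 < m := Real.sqrt_pos.2 hpos
  have hm2 : m ^ 2 * α = β := by
    rw [hm, Real.sq_sqrt hpos.le]; field_simp
  set l := Real.sqrt m with hl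
  have hl0 : 0 < l := Real.sqrt_pos.2 hm0
  have hl2 : l ^ 2 = m := Real.sq_sqrt hm0.le
  set κ := m * (α / β + 1) with hκ
  have hκ0 : 0 < κ := by
    have : 0 < α / β := by rw [← inv_div]; exact inv_pos.2 hpos
    positivity
  have hκβ : κ * β = m * (α + β) := by rw [hκ]; field_simp
  refine ⟨c * l, -s, a * (c * l) + b * (s * l), b * c - a * s, 8 / ((6 + κ) * (b ^ 2 * β)),
    (2 - κ) / (6 + κ), ?_, by positivity, ?_, fun x y => ?_⟩
  · have : c * l * (b * c - a * s) - -s * (a * (c * l) + b * (s * l)) = b * l := by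
      linear_combination b * l * hsc
    rw [this]
    positivity
  · rw [abs_div, abs_of_pos (show 0 < 6 + κ by linarith), div_lt_one (by linarith), abs_lt]
    constructor <;> linarith
  · have e1 : c * l * x + -s * y = c * (l * x) - s * y := by ring
    have e2 : (a * (c * l) + b * (s * l)) * x + (b * c - a * s) * y =
      a * (c * (l * x) - s * y) + b * (s * (l * x) + c * y) := by ring
    rw [e1, e2, hdiag]
    have e3 : ((l * x) ^ 2 + y ^ 2) * (α * (l * x) ^ 2 + β * y ^ 2) =
        β * (x ^ 4 + κ * x ^ 2 * y ^ 2 + y ^ 4) := by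
      simp only [mul_pow, hl2]
      linear_combination x ^ 4 * hm2 - x ^ 2 * y ^ 2 * hκβ
    rw [e3]
    field_simp
    ring

/-! ### Frames of `ℝ³` with their dual bases -/

/-- `e` is a basis of `ℝ³` with dual basis `d`. -/
def IsFrame (e d : Fin 3 → Fin 3 → ℝ) : Prop :=
  ∀ i j, lin (d i) (e j) = if i = j then 1 else 0

lemma lin_smul_right {R : Type*} [CommSemiring R] (ℓ p : Fin 3 → R) (c : R) :
    lin ℓ (c • p) = c * lin ℓ p := by
  simp only [lin, Pi.smul_apply, smul_eq_mul, Finset.mul_sum]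
  exact Finset.sum_congr rfl fun i _ => by ring

lemma lin_add_right {R : Type*} [CommSemiring R] (ℓ p q : Fin 3 → R) :
    lin ℓ (p + q) = lin ℓ p + lin ℓ q := by
  simp only [lin, Pi.add_apply, mul_add, Finset.sum_add_distrib]

lemma lin_smul_left {R : Type*} [CommSemiring R] (ℓ p : Fin 3 → R) (c : R) :
    lin (c • ℓ) p = c * lin ℓ p := by
  simp only [lin, Pi.smul_apply, smul_eq_mul, Finset.mul_sum, mul_assoc]

lemma lin_add_left {R : Type*} [CommSemiring R] (ℓ ℓ' p : Fin 3 → R) :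
    lin (ℓ + ℓ') p = lin ℓ p + lin ℓ' p := by
  simp only [lin, Pi.add_apply, add_mul, Finset.sum_add_distrib]

lemma lin_cvec (ℓ p : Fin 3 → ℝ) : lin (cvec ℓ) (cvec p) = (lin ℓ p : ℝ) := by
  simp [lin, cvec]

lemma cvec_smul (c : ℝ) (p : Fin 3 → ℝ) : cvec (c • p) = (c : ℂ) • cvec p := by
  ext i; simp [cvec]

lemma cvec_ne_zero {p : Fin 3 → ℝ} (hp : p ≠ 0) : cvec p ≠ 0 := fun h =>
  hp (funext fun i => by simpa [cvec] using congrFun h i)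

lemma IsFrame.sum_mul {e d : Fin 3 → Fin 3 → ℝ} (h : IsFrame e d) (a b : Fin 3) :
    ∑ i, e i a * d i b = if a = b then 1 else 0 := by
  have h1 : Matrix.of d * (Matrix.of e).transpose = 1 := by
    ext i j
    rw [Matrix.mul_apply, Matrix.one_apply, ← h i j]
    rfl
  have h2 := congrArg (fun M => M a b) (mul_eq_one_comm.1 h1)
  rwa [Matrix.mul_apply, Matrix.one_apply] at h2

lemma IsFrame.cvec_decomp {e d : Fin 3 → Fin 3 → ℝ} (h : IsFrame e d) (z : Fin 3 → ℂ) :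
    ∑ i, lin (cvec (d i)) z • cvec (e i) = z := by
  ext a
  have h1 : ∀ b, ∑ i, (e i a : ℂ) * d i b = if a = b then 1 else 0 := fun b => by
    have := congrArg (fun x : ℝ => (x : ℂ)) (h.sum_mul a b)
    rw [apply_ite (fun x : ℝ => (x : ℂ))] at this
    push_cast at this
    exact this
  calc (∑ i, lin (cvec (d i)) z • cvec (e i)) a
      = ∑ b, (∑ i, (e i a : ℂ) * d i b) * z b := by
        simp only [lin, cvec, Finset.sum_apply, Pi.smul_apply, smul_eq_mul, Finset.sum_mul]
        rw [Finset.sum_comm]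
        exact Finset.sum_congr rfl fun i _ => Finset.sum_congr rfl fun j _ => by ring
    _ = z a := by simp [h1]

lemma IsFrame.decomp_left {e d : Fin 3 → Fin 3 → ℝ} (h : IsFrame e d) (w : Fin 3 → ℝ) :
    ∑ i, lin w (e i) • d i = w := by
  ext b
  calc (∑ i, lin w (e i) • d i) b = ∑ a, (∑ i, e i a * d i b) * w a := by
        simp only [lin, Finset.sum_apply, Pi.smul_apply, smul_eq_mul, Finset.sum_mul]
        rw [Finset.sum_comm]
        exact Finset.sum_congr rfl fun i _ => Finset.sum_congr rfl fun j _ => by ring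
    _ = w b := by simp [h.sum_mul]

lemma exists_isFrame {ℓ : Fin 3 → ℝ} (hℓ : ℓ ≠ 0) : ∃ e d, IsFrame e d ∧ d 2 = ℓ := by
  obtain ⟨i, hi⟩ : ∃ i, ℓ i ≠ 0 := Function.ne_iff.1 hℓ
  obtain ⟨j, k, hij, hik, hjk⟩ : ∃ j k : Fin 3, i ≠ j ∧ i ≠ k ∧ j ≠ k := by
    clear hi
    revert i
    decide
  refine ⟨![Pi.single j 1 - (ℓ j / ℓ i) • Pi.single i 1, Pi.single k 1 - (ℓ k / ℓ i) • Pi.single i 1,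
    (ℓ i)⁻¹ • Pi.single i 1], ![Pi.single j 1, Pi.single k 1, ℓ], ?_, rfl⟩
  intro a b
  fin_cases a <;> fin_cases b <;>
    simp [lin, mul_sub, Pi.single_apply, hij, hik, hjk, hjk.symm, hi] <;>
    field_simp <;> simp

/-- Coordinates adapted to a line without real points of a quartic. -/
lemma exists_adapted_frame {f : MvPolynomial (Fin 3) ℝ} (hf : f.IsHomogeneous 4)
    {ℓ : Fin 3 → ℝ} (hℓ : ℓ ≠ 0) (hno : ∀ p : Fin 3 → ℝ, p ≠ 0 → lin ℓ p = 0 → eval p f ≠ 0) :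
    ∃ (e d : Fin 3 → Fin 3 → ℝ) (σ k : ℝ), IsFrame e d ∧ d 2 = ℓ ∧ σ ≠ 0 ∧ |k| < 1 ∧
      ∀ x y : ℂ, cev (C σ * f) (x • cvec (e 0) + y • cvec (e 1)) =
        (x ^ 2 + y ^ 2) ^ 2 + k * (x ^ 4 - 6 * x ^ 2 * y ^ 2 + y ^ 4) := by
  obtain ⟨e, d, he, hd⟩ := exists_isFrame hℓ
  have hform := cev_add_smul hf (e 0) (e 1)
  set c := (lineRestrict (e 0) (e 1) f).coeff
  obtain ⟨p, q, r, s, σ, k, hdet, hσ, hk, hnorm⟩ := exists_binary_normal_form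
    (c₀ := c 0) (c₁ := c 1) (c₂ := c 2) (c₃ := c 3) (c₄ := c 4) (by
      intro x y h0
      by_contra hxy
      have h1 : ∀ i, lin (d i) (x • e 0 + y • e 1) = ![x, y, 0] i := by
        intro i
        rw [lin_add_right, lin_smul_right, lin_smul_right, he, he]
        fin_cases i <;> simp
      refine hno (x • e 0 + y • e 1) (fun hz => hxy ?_) (hd ▸ h1 2) ?_
      · rw [hz] at h1
        have h2 := h1 0
        have h3 := h1 1
        simp [lin] at h2 h3
        exact ⟨h2.symm, h3.symm⟩
      · have h4 := hform x y
        rw [← cvec_smul, ← cvec_smul, show cvec (x • e 0) + cvec (y • e 1) =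
          cvec (x • e 0 + y • e 1) by ext i; simp [cvec], cev_cvec] at h4
        rw [← h0]
        exact_mod_cast h4)
  refine ⟨![p • e 0 + r • e 1, q • e 0 + s • e 1, e 2],
    ![(s / (p * s - q * r)) • d 0 + (-q / (p * s - q * r)) • d 1,
      (-r / (p * s - q * r)) • d 0 + (p / (p * s - q * r)) • d 1, d 2],
    σ, k, ?_, hd, hσ, hk, fun x y => ?_⟩
  · intro i j
    fin_cases i <;> fin_cases j <;>
      simp [lin_add_right, lin_smul_right, lin_add_left, lin_smul_left, he _ _] <;>
      field_simp <;> ring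
  · have hC : ∀ z, cev (C σ * f) z = σ * cev f z := fun z => by simp [cev, cmap]
    have hz : x • cvec (p • e 0 + r • e 1) + y • cvec (q • e 0 + s • e 1) =
        (p * x + q * y) • cvec (e 0) + (r * x + s * y) • cvec (e 1) := by
      ext i
      simp [cvec]
      ring
    have hpoly : ∀ x y : ℂ, σ * ((c 0 : ℂ) * (p * x + q * y) ^ 4 +
        c 1 * (p * x + q * y) ^ 3 * (r * x + s * y) +
        c 2 * (p * x + q * y) ^ 2 * (r * x + s * y) ^ 2 +
        c 3 * (p * x + q * y) * (r * x + s * y) ^ 3 + c 4 * (r * x + s * y) ^ 4) =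
        (x ^ 2 + y ^ 2) ^ 2 + k * (x ^ 4 - 6 * x ^ 2 * y ^ 2 + y ^ 4) := by
      intro x y
      have cast : ∀ x y : ℝ, _ := fun x y => congrArg (fun t : ℝ => (t : ℂ)) (hnorm x y)
      push_cast at cast
      have h1 := cast 1 0
      have h2 := cast 0 1
      have h3 := cast 1 1
      have h4 := cast 1 (-1)
      have h5 := cast 1 2
      push_cast at h1 h2 h3 h4 h5
      linear_combination x * (y - x) * (y + x) * (y - 2 * x) / 2 * h1 +
        y * (y - x) * (y + x) * (y - 2 * x) * h2 - x * y * (y + x) * (y - 2 * x) / 2 * h3 -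
        x * y * (y - x) * (y - 2 * x) / 6 * h4 + x * y * (y - x) * (y + x) / 6 * h5
    simp only [Matrix.cons_val_zero, Matrix.cons_val_one]
    rw [hC, hz, hform, hpoly]

/-! ### Bitangents in an adapted frame -/

/-- The quartic `∑ aᵢ tⁱ` is `a₄ ((t - τ₁) (t - τ₂)) ^ 2`. -/
def IsSquareWithRoots (a : ℕ → ℝ) (τ₁ τ₂ : ℂ) : Prop :=
  (a 3 : ℂ) = -2 * a 4 * (τ₁ + τ₂) ∧ (a 2 : ℂ) = a 4 * ((τ₁ + τ₂) ^ 2 + 2 * (τ₁ * τ₂)) ∧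
  (a 1 : ℂ) = -2 * a 4 * (τ₁ + τ₂) * (τ₁ * τ₂) ∧ (a 0 : ℂ) = a 4 * (τ₁ * τ₂) ^ 2

/-- First condition for the quartic `∑ aᵢ tⁱ` to be proportional to a square. -/
def squareU (a : ℕ → ℝ) : ℝ := 8 * a 4 ^ 2 * a 1 - 4 * a 4 * a 3 * a 2 + a 3 ^ 3

/-- Second condition for the quartic `∑ aᵢ tⁱ` to be proportional to a square. -/
def squareV (a : ℕ → ℝ) : ℝ := 64 * a 4 ^ 3 * a 0 - (4 * a 4 * a 2 - a 3 ^ 2) ^ 2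

lemma IsSquareWithRoots.squareU_eq_zero {a : ℕ → ℝ} {τ₁ τ₂ : ℂ} (h : IsSquareWithRoots a τ₁ τ₂) :
    squareU a = 0 := by
  obtain ⟨h3, h2, h1, -⟩ := h
  have : (squareU a : ℂ) = 0 := by
    rw [squareU]; push_cast; rw [h3, h2, h1]; ring
  exact_mod_cast this

lemma IsSquareWithRoots.squareV_eq_zero {a : ℕ → ℝ} {τ₁ τ₂ : ℂ} (h : IsSquareWithRoots a τ₁ τ₂) :
    squareV a = 0 := by
  obtain ⟨h3, h2, -, h0⟩ := h
  have : (squareV a : ℂ) = 0 := by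
    rw [squareV]; push_cast; rw [h3, h2, h0]; ring
  exact_mod_cast this

lemma exists_isSquareWithRoots {a : ℕ → ℝ} (h4 : a 4 ≠ 0) (hu : squareU a = 0)
    (hv : squareV a = 0) : ∃ τ₁ τ₂, IsSquareWithRoots a τ₁ τ₂ := by
  have h4' : (a 4 : ℂ) ≠ 0 := by exact_mod_cast h4
  have hu' : (8 * a 4 ^ 2 * a 1 - 4 * a 4 * a 3 * a 2 + a 3 ^ 3 : ℂ) = 0 := by exact_mod_cast hu
  have hv' : (64 * a 4 ^ 3 * a 0 - (4 * a 4 * a 2 - a 3 ^ 2) ^ 2 : ℂ) = 0 := by exact_mod_cast hv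
  set s : ℂ := -a 3 / (2 * a 4) with hs
  set p : ℂ := (4 * a 4 * a 2 - a 3 ^ 2) / (8 * a 4 ^ 2) with hp
  obtain ⟨w, hw⟩ := IsAlgClosed.exists_pow_nat_eq (s ^ 2 - 4 * p) (n := 2) (by norm_num)
  have hsum : (s + w) / 2 + (s - w) / 2 = s := by ring
  have hprod : (s + w) / 2 * ((s - w) / 2) = p := by linear_combination -hw / 4
  refine ⟨(s + w) / 2, (s - w) / 2, ?_⟩
  rw [IsSquareWithRoots, hsum, hprod, hs, hp]
  refine ⟨?_, ?_, ?_, ?_⟩ <;> field_simp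
  · ring
  · linear_combination hu'
  · linear_combination hv'

lemma cev_C_mul (σ : ℝ) (f : MvPolynomial (Fin 3) ℝ) (z : Fin 3 → ℂ) :
    cev (C σ * f) z = σ * cev f z := by simp [cev, cmap]

lemma isBitangentAt_C_mul {σ : ℝ} (hσ : σ ≠ 0) {f : MvPolynomial (Fin 3) ℝ} {ℓ z₁ z₂ : Fin 3 → ℂ} :
    IsBitangentAt (C σ * f) ℓ z₁ z₂ ↔ IsBitangentAt f ℓ z₁ z₂ := by
  have key : ∀ {σ : ℝ}, σ ≠ 0 → ∀ {f}, IsBitangentAt f ℓ z₁ z₂ → IsBitangentAt (C σ * f) ℓ z₁ z₂ := by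
    rintro σ hσ f ⟨h1, h2, h3, h4, h5, m₁, m₂, c, hc, h6, h7, h8, h9, h10⟩
    refine ⟨h1, h2, h3, h4, h5, m₁, m₂, σ * c, mul_ne_zero (by exact_mod_cast hσ) hc, h6, h7, h8, h9,
      fun p hp => ?_⟩
    rw [cev_C_mul, h10 p hp, mul_assoc]
  refine ⟨fun h => ?_, key hσ⟩
  have h' := key (inv_ne_zero hσ) h
  rwa [← mul_assoc, ← map_mul, inv_mul_cancel₀ hσ, map_one, one_mul] at h'

section

variable {f : MvPolynomial (Fin 3) ℝ} {e d : Fin 3 → Fin 3 → ℝ}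

lemma IsFrame.eq_of_lin_eq_zero (h : IsFrame e d) {z : Fin 3 → ℂ} (hz : lin (cvec (d 2)) z = 0) :
    lin (cvec (d 0)) z • cvec (e 0) + lin (cvec (d 1)) z • cvec (e 1) = z := by
  conv_rhs => rw [← h.cvec_decomp z]
  rw [Fin.sum_univ_three, hz, zero_smul, add_zero]

lemma IsFrame.lin_add_smul (h : IsFrame e d) (x y : ℂ) (i : Fin 3) :
    lin (cvec (d i)) (x • cvec (e 0) + y • cvec (e 1)) = ![x, y, 0] i := by
  rw [lin_add_right, lin_smul_right, lin_smul_right, lin_cvec, lin_cvec, h, h]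
  fin_cases i <;> simp

lemma IsBitangentAt.exists_roots (hf : f.IsHomogeneous 4) (he : IsFrame e d)
    (h4 : eval (e 1) f ≠ 0) {c : ℂ} (hc : c ≠ 0) {z₁ z₂ : Fin 3 → ℂ}
    (h : IsBitangentAt f (c • cvec (d 2)) z₁ z₂) :
    ∃ x₁ x₂ τ₁ τ₂ : ℂ, x₁ ≠ 0 ∧ x₂ ≠ 0 ∧ z₁ = x₁ • (cvec (e 0) + τ₁ • cvec (e 1)) ∧
      z₂ = x₂ • (cvec (e 0) + τ₂ • cvec (e 1)) ∧
      IsSquareWithRoots (lineRestrict (e 0) (e 1) f).coeff τ₁ τ₂ := by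
  have hlin : ∀ p, lin (c • cvec (d 2)) p = 0 ↔ lin (cvec (d 2)) p = 0 := fun p => by
    rw [lin_smul_left, mul_eq_zero, or_iff_right hc]
  simp only [IsBitangentAt, hlin] at h
  obtain ⟨-, hz1, hz2, hl1, hl2, m₁, m₂, k, hk, hm1, hm2, -, -, hsq⟩ := h
  have hform : ∀ x y : ℂ, _ := fun x y => (cev_add_smul hf (e 0) (e 1) x y).symm.trans
    (hsq (x • cvec (e 0) + y • cvec (e 1)) (he.lin_add_smul x y 2))
  have h4' : ((lineRestrict (e 0) (e 1) f).coeff 4 : ℂ) ≠ 0 := by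
    rw [coeff_lineRestrict_four hf]; exact_mod_cast h4
  set a := (lineRestrict (e 0) (e 1) f).coeff
  simp only [lin_add_right, lin_smul_right] at hform
  set α₁ := lin m₁ (cvec (e 0))
  set β₁ := lin m₁ (cvec (e 1)) with hβ₁
  set α₂ := lin m₂ (cvec (e 0))
  set β₂ := lin m₂ (cvec (e 1)) with hβ₂
  have ha4 : (a 4 : ℂ) = k * (β₁ * β₂) ^ 2 := by linear_combination hform 0 1
  have hβ₁0 : β₁ ≠ 0 := fun h0 => h4' (by rw [ha4, h0]; ring)
  have hβ₂0 : β₂ ≠ 0 := fun h0 => h4' (by rw [ha4, h0]; ring)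
  have point : ∀ {z m : Fin 3 → ℂ}, z ≠ 0 → lin (cvec (d 2)) z = 0 → lin m z = 0 →
      lin m (cvec (e 1)) ≠ 0 → ∃ x : ℂ, x ≠ 0 ∧
        z = x • (cvec (e 0) + (-(lin m (cvec (e 0)) / lin m (cvec (e 1)))) • cvec (e 1)) := by
    intro z m hz hl hm hb
    have h1 := he.eq_of_lin_eq_zero hl
    set x := lin (cvec (d 0)) z
    set y := lin (cvec (d 1)) z
    rw [← h1, lin_add_right, lin_smul_right, lin_smul_right] at hm
    have hy : x * (-(lin m (cvec (e 0)) / lin m (cvec (e 1)))) = y := by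
      field_simp
      linear_combination -hm
    refine ⟨x, fun hx => hz ?_, ?_⟩
    · rw [← h1, ← hy, hx]; simp
    · rw [smul_add, smul_smul, hy, h1]
  obtain ⟨x₁, hx₁, hzx₁⟩ := point hz1 hl1 hm1 hβ₁0
  obtain ⟨x₂, hx₂, hzx₂⟩ := point hz2 hl2 hm2 hβ₂0
  refine ⟨x₁, x₂, _, _, hx₁, hx₂, hzx₁, hzx₂, ?_⟩
  rw [← hβ₁, ← hβ₂]
  have f1 := hform 1 0
  have f2 := hform 1 1
  have f3 := hform 1 (-1)
  have f4 := hform 1 2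
  have a0 : (a 0 : ℂ) = k * (α₁ * α₂) ^ 2 := by linear_combination f1
  have a2 : (a 2 : ℂ) = k * ((α₁ * β₂ + α₂ * β₁) ^ 2 + 2 * (α₁ * α₂ * (β₁ * β₂))) := by
    linear_combination (f2 + f3) / 2 - a0 - ha4
  have a13 : (a 1 : ℂ) + a 3 = 2 * k * (α₁ * β₂ + α₂ * β₁) * (α₁ * α₂ + β₁ * β₂) := by
    linear_combination (f2 - f3) / 2
  have a3 : (a 3 : ℂ) = 2 * k * (α₁ * β₂ + α₂ * β₁) * (β₁ * β₂) := by
    linear_combination (f4 - a0 - 4 * a2 - 16 * ha4 - 2 * a13) / 6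
  have a1 : (a 1 : ℂ) = 2 * k * (α₁ * β₂ + α₂ * β₁) * (α₁ * α₂) := by
    linear_combination a13 - a3
  refine ⟨?_, ?_, ?_, ?_⟩
  · rw [a3, ha4]; field_simp; ring
  · rw [a2, ha4]; field_simp; ring
  · rw [a1, ha4]; field_simp; ring
  · rw [a0, ha4]; field_simp; rfl

lemma IsSquareWithRoots.isBitangentAt (hf : f.IsHomogeneous 4) (he : IsFrame e d)
    (h4 : eval (e 1) f ≠ 0) {c : ℂ} (hc : c ≠ 0) {τ₁ τ₂ : ℂ}
    (h : IsSquareWithRoots (lineRestrict (e 0) (e 1) f).coeff τ₁ τ₂) {x₁ x₂ : ℂ}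
    (hx₁ : x₁ ≠ 0) (hx₂ : x₂ ≠ 0) :
    IsBitangentAt f (c • cvec (d 2)) (x₁ • (cvec (e 0) + τ₁ • cvec (e 1)))
      (x₂ • (cvec (e 0) + τ₂ • cvec (e 1))) := by
  have hlin : ∀ p, lin (c • cvec (d 2)) p = 0 ↔ lin (cvec (d 2)) p = 0 := fun p => by
    rw [lin_smul_left, mul_eq_zero, or_iff_right hc]
  have hpt : ∀ (x τ : ℂ) i, lin (cvec (d i)) (x • (cvec (e 0) + τ • cvec (e 1))) =
      ![x, x * τ, 0] i := fun x τ i => by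
    rw [smul_add, smul_smul, he.lin_add_smul]
  have hne : ∀ {x : ℂ} (τ : ℂ), x ≠ 0 → x • (cvec (e 0) + τ • cvec (e 1)) ≠ 0 := fun {x} τ hx h0 => by
    have := hpt x τ 0
    rw [h0] at this
    simp [lin] at this
    exact hx this.symm
  have hm : ∀ (τ : ℂ) p, lin (cvec (d 1) + (-τ) • cvec (d 0)) p =
      lin (cvec (d 1)) p - τ * lin (cvec (d 0)) p := fun τ p => by
    rw [lin_add_left, lin_smul_left]; ring
  have hB : ∀ i, lin (cvec (d i)) (cvec (e 1)) = ![0, 1, 0] i := fun i => by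
    rw [lin_cvec, he]; fin_cases i <;> simp
  have hmB : ∀ τ : ℂ, lin (cvec (d 1)) (cvec (e 1)) - τ * lin (cvec (d 0)) (cvec (e 1)) ≠ 0 := by
    intro τ; rw [hB, hB]; simp
  have hd2 : d 2 ≠ 0 := fun h0 => by
    have := he 2 2
    rw [h0] at this
    simp [lin] at this
  simp only [IsBitangentAt, hlin]
  refine ⟨smul_ne_zero hc (cvec_ne_zero hd2), hne τ₁ hx₁, hne τ₂ hx₂, hpt _ _ 2, hpt _ _ 2,
    cvec (d 1) + (-τ₁) • cvec (d 0), cvec (d 1) + (-τ₂) • cvec (d 0),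
    (lineRestrict (e 0) (e 1) f).coeff 4, ?_, ?_, ?_, ⟨cvec (e 1), hB 2, ?_⟩,
    ⟨cvec (e 1), hB 2, ?_⟩, fun p hp => ?_⟩
  · rw [coeff_lineRestrict_four hf]; exact_mod_cast h4
  · rw [hm, hpt, hpt]; simp [mul_comm]
  · rw [hm, hpt, hpt]; simp [mul_comm]
  · rw [hm]; exact hmB _
  · rw [hm]; exact hmB _
  · rw [hm, hm]
    have h1 := cev_add_smul hf (e 0) (e 1) (lin (cvec (d 0)) p) (lin (cvec (d 1)) p)
    rw [he.eq_of_lin_eq_zero hp] at h1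
    obtain ⟨h3, h2, h1', h0⟩ := h
    rw [h1, h3, h2, h1', h0]
    ring

lemma aeval_lineRestrict_eq (hf : f.IsHomogeneous 4) (A B : Fin 3 → ℝ) {τ₁ τ₂ : ℂ}
    (h : IsSquareWithRoots (lineRestrict A B f).coeff τ₁ τ₂) (t : ℂ) :
    Polynomial.aeval t (lineRestrict A B f) =
      (lineRestrict A B f).coeff 4 * ((t - τ₁) * (t - τ₂)) ^ 2 ∧
    Polynomial.aeval t (Polynomial.derivative (lineRestrict A B f)) =
      (lineRestrict A B f).coeff 4 * (2 * ((t - τ₁) * (t - τ₂)) * ((t - τ₁) + (t - τ₂))) := by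
  obtain ⟨h3, h2, h1, h0⟩ := h
  have hd := natDegree_lineRestrict_le hf A B
  constructor
  · rw [Polynomial.aeval_eq_sum_range' (Nat.lt_succ_of_le hd)]
    simp only [Finset.sum_range_succ, Finset.sum_range_zero, Complex.real_smul]
    rw [h3, h2, h1, h0]
    ring
  · rw [Polynomial.aeval_eq_sum_range' (n := 4)
      (Nat.lt_succ_of_le ((Polynomial.natDegree_derivative_le _).trans (Nat.sub_le_sub_right hd 1)))]
    simp only [Finset.sum_range_succ, Finset.sum_range_zero, Complex.real_smul,
      Polynomial.coeff_derivative]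
    push_cast
    norm_num only
    rw [h3, h2, h1]
    ring

/-- At a point where `f` restricted to the line vanishes doubly, a directional derivative only sees
the normal component of the direction. -/
lemma Dv_of_double_root (hf : f.IsHomogeneous 4) (he : IsFrame e d) {t x : ℂ}
    (h0 : Polynomial.aeval t (lineRestrict (e 0) (e 1) f) = 0)
    (h1 : Polynomial.aeval t (Polynomial.derivative (lineRestrict (e 0) (e 1) f)) = 0)
    (v : Fin 3 → ℝ) :
    Dv f v (x • (cvec (e 0) + t • cvec (e 1))) = x ^ 3 * (lin (d 2) v : ℝ) *
      Polynomial.aeval t (lineRestrict (e 0) (e 1) (dirDeriv (e 2) f)) := by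
  have hA : Dv f (e 0) (cvec (e 0) + t • cvec (e 1)) = 0 := by
    rw [← cev_dirDeriv, ← aeval_lineRestrict, lineRestrict_dirDeriv_left hf]
    simp [h0, h1]
  have hB : Dv f (e 1) (cvec (e 0) + t • cvec (e 1)) = 0 := by
    rw [← cev_dirDeriv, ← aeval_lineRestrict, lineRestrict_dirDeriv_right, h1]
  have hv : Dv f v (cvec (e 0) + t • cvec (e 1)) =
      (lin (d 2) v : ℝ) * Dv f (e 2) (cvec (e 0) + t • cvec (e 1)) := by
    have h2 : ∀ j, (v j : ℂ) = ∑ i, ((lin (d i) v : ℝ) : ℂ) * e i j := fun j => by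
      have := congrFun (he.cvec_decomp (cvec v)) j
      simp only [lin_cvec, Finset.sum_apply, Pi.smul_apply, smul_eq_mul, cvec] at this
      exact this.symm
    have h3 : ∀ z, Dv f v z = ∑ i, ((lin (d i) v : ℝ) : ℂ) * Dv f (e i) z := fun z => by
      simp only [Dv, h2, Finset.mul_sum, Finset.sum_mul]
      rw [Finset.sum_comm]
      exact Finset.sum_congr rfl fun i _ => Finset.sum_congr rfl fun j _ => by ring
    rw [h3, Fin.sum_univ_three, hA, hB]
    ring
  rw [← cev_dirDeriv, cev_smul (isHomogeneous_dirDeriv hf v), cev_dirDeriv, hv,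
    aeval_lineRestrict, cev_dirDeriv, mul_assoc]

lemma aeval_normal_ne_zero (hf : f.IsHomogeneous 4) (hsm : SmoothQuartic f) (he : IsFrame e d) {t : ℂ}
    (h0 : Polynomial.aeval t (lineRestrict (e 0) (e 1) f) = 0)
    (h1 : Polynomial.aeval t (Polynomial.derivative (lineRestrict (e 0) (e 1) f)) = 0) :
    Polynomial.aeval t (lineRestrict (e 0) (e 1) (dirDeriv (e 2) f)) ≠ 0 := by
  intro h2
  have hne : cvec (e 0) + t • cvec (e 1) ≠ 0 := fun hz => by
    have := he.lin_add_smul 1 t 0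
    rw [one_smul, hz] at this
    simp [lin] at this
  obtain ⟨i, hi⟩ := hsm _ hne (by rw [← aeval_lineRestrict, h0])
  refine hi ?_
  have := Dv_of_double_root hf he (x := 1) h0 h1 (Pi.single i 1)
  rw [h2, mul_zero, one_smul] at this
  simpa [Dv, Pi.single_apply, apply_ite Complex.ofReal] using this

end

/-! ### The moving frame parametrizing the affine lines -/

/-- The frame `e` rotated by the angles `p.1` and `p.2`. -/
def movingFrame (e : Fin 3 → Fin 3 → ℝ) (p : ℝ × ℝ) : Fin 3 → Fin 3 → ℝ :=
  ![Real.sin p.2 • (Real.cos p.1 • e 0 + Real.sin p.1 • e 1) + Real.cos p.2 • e 2,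
    -Real.sin p.1 • e 0 + Real.cos p.1 • e 1,
    Real.cos p.2 • (Real.cos p.1 • e 0 + Real.sin p.1 • e 1) - Real.sin p.2 • e 2]

lemma IsFrame.movingFrame {e d : Fin 3 → Fin 3 → ℝ} (h : IsFrame e d) (p : ℝ × ℝ) :
    IsFrame (movingFrame e p) (movingFrame d p) := by
  have h1 := Real.sin_sq_add_cos_sq p.1
  have h2 := Real.sin_sq_add_cos_sq p.2
  intro i j
  fin_cases i <;> fin_cases j <;>
    simp [_root_.movingFrame, lin_add_right, lin_smul_right, lin_add_left, lin_smul_left, h _ _,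
      sub_eq_add_neg, ← neg_smul] <;>
    ring_nf
  · linear_combination Real.sin p.2 ^ 2 * h1 + h2
  · linear_combination Real.sin p.2 * Real.cos p.2 * h1
  · linear_combination h1
  · linear_combination Real.sin p.2 * Real.cos p.2 * h1
  · linear_combination Real.cos p.2 ^ 2 * h1 + h2

/-- Coefficients of the restriction of `f` to the line spanned by the first two vectors of the
moving frame. -/
def lineCoeff (f : MvPolynomial (Fin 3) ℝ) (e : Fin 3 → Fin 3 → ℝ) (p : ℝ × ℝ) : ℕ → ℝ :=
  (lineRestrict (movingFrame e p 0) (movingFrame e p 1) f).coeff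

/-- Coefficients of the restriction of the normal derivative of `f`. -/
def normalCoeff (f : MvPolynomial (Fin 3) ℝ) (e : Fin 3 → Fin 3 → ℝ) (p : ℝ × ℝ) : ℕ → ℝ :=
  lineCoeff (dirDeriv (movingFrame e p 2) f) e p

lemma contDiff_movingFrame (e : Fin 3 → Fin 3 → ℝ) (i : Fin 3) {n : WithTop ℕ∞} :
    ContDiff ℝ n fun p => movingFrame e p i := by
  fin_cases i <;> simp [movingFrame] <;> fun_prop

lemma contDiff_lineCoeff (f : MvPolynomial (Fin 3) ℝ) (e : Fin 3 → Fin 3 → ℝ) (i : ℕ)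
    {n : WithTop ℕ∞} : ContDiff ℝ n fun p => lineCoeff f e p i :=
  contDiff_coeff_lineRestrict (contDiff_movingFrame e 0) (contDiff_movingFrame e 1) f i

lemma contDiff_squareU (f : MvPolynomial (Fin 3) ℝ) (e : Fin 3 → Fin 3 → ℝ) {n : WithTop ℕ∞} :
    ContDiff ℝ n fun p => squareU (lineCoeff f e p) := by
  have := fun i => contDiff_lineCoeff f e i (n := n)
  unfold squareU
  fun_prop

lemma contDiff_squareV (f : MvPolynomial (Fin 3) ℝ) (e : Fin 3 → Fin 3 → ℝ) {n : WithTop ℕ∞} :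
    ContDiff ℝ n fun p => squareV (lineCoeff f e p) := by
  have := fun i => contDiff_lineCoeff f e i (n := n)
  unfold squareV
  fun_prop

lemma hasDerivAt_squareU {a : ℝ → ℕ → ℝ} {a' : ℕ → ℝ} {x : ℝ}
    (h : ∀ i, HasDerivAt (fun t => a t i) (a' i) x) :
    HasDerivAt (fun t => squareU (a t))
      (16 * a x 4 * a' 4 * a x 1 + 8 * a x 4 ^ 2 * a' 1 - 4 * a' 4 * a x 3 * a x 2 -
        4 * a x 4 * a' 3 * a x 2 - 4 * a x 4 * a x 3 * a' 2 + 3 * a x 3 ^ 2 * a' 3) x := by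
  unfold squareU
  refine ((((((h 4).pow 2).const_mul 8).mul (h 1)).sub
    ((((h 4).const_mul 4).mul (h 3)).mul (h 2))).add ((h 3).pow 3)).congr_deriv ?_
  simp
  ring

lemma hasDerivAt_squareV {a : ℝ → ℕ → ℝ} {a' : ℕ → ℝ} {x : ℝ}
    (h : ∀ i, HasDerivAt (fun t => a t i) (a' i) x) :
    HasDerivAt (fun t => squareV (a t))
      (192 * a x 4 ^ 2 * a' 4 * a x 0 + 64 * a x 4 ^ 3 * a' 0 -
        2 * (4 * a x 4 * a x 2 - a x 3 ^ 2) *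
          (4 * a' 4 * a x 2 + 4 * a x 4 * a' 2 - 2 * a x 3 * a' 3)) x := by
  unfold squareV
  refine (((((h 4).pow 3).const_mul 64).mul (h 0)).sub
    (((((h 4).const_mul 4).mul (h 2)).sub ((h 3).pow 2)).pow 2)).congr_deriv ?_
  simp only [Pi.mul_apply, Pi.sub_apply, Pi.pow_apply]
  push_cast
  ring

lemma hasDerivAt_lineCoeff_snd (f : MvPolynomial (Fin 3) ℝ) (e : Fin 3 → Fin 3 → ℝ) (x y : ℝ)
    (i : ℕ) : HasDerivAt (fun t => lineCoeff f e (x, t) i) (normalCoeff f e (x, y) i) y := by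
  have hA : HasDerivAt (fun t => movingFrame e (x, t) 0) (movingFrame e (x, y) 2) y := by
    refine (((Real.hasDerivAt_sin y).smul_const (Real.cos x • e 0 + Real.sin x • e 1)).add
      ((Real.hasDerivAt_cos y).smul_const (e 2))).congr_deriv ?_
    simp [movingFrame, sub_eq_add_neg]
  have hB : HasDerivAt (fun t => movingFrame e (x, t) 1) 0 y :=
    hasDerivAt_const y (movingFrame e (x, y) 1)
  refine (hasDerivAt_coeff_lineRestrict hA hB f i).congr_deriv ?_
  have h0 : dirDeriv 0 f = 0 := by simp [dirDeriv]
  rw [h0, map_zero, mul_zero, add_zero, normalCoeff, lineCoeff]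

lemma hasDerivAt_lineCoeff_fst {f : MvPolynomial (Fin 3) ℝ} (hf : f.IsHomogeneous 4)
    (e : Fin 3 → Fin 3 → ℝ) (x y : ℝ) (i : ℕ) :
    HasDerivAt (fun t => lineCoeff f e (t, y) i)
      ((i + 1) * Real.sin y * lineCoeff f e (x, y) (i + 1) + if i = 0 then 0 else
        ((i - 5) * Real.sin y * lineCoeff f e (x, y) (i - 1) -
          Real.cos y * normalCoeff f e (x, y) (i - 1))) x := by
  have hA : HasDerivAt (fun t => movingFrame e (t, y) 0)
      (Real.sin y • movingFrame e (x, y) 1 + (0 : ℝ) • 0) x := by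
    refine ((((Real.hasDerivAt_cos x).smul_const (e 0)).add
      ((Real.hasDerivAt_sin x).smul_const (e 1))).const_smul (Real.sin y)).add_const
      (Real.cos y • e 2) |>.congr_deriv ?_
    simp [movingFrame]
  have hB : HasDerivAt (fun t => movingFrame e (t, y) 1)
      (-Real.sin y • movingFrame e (x, y) 0 + -Real.cos y • movingFrame e (x, y) 2) x := by
    refine ((((Real.hasDerivAt_sin x).neg).smul_const (e 0)).add
      ((Real.hasDerivAt_cos x).smul_const (e 1))).congr_deriv ?_
    ext j
    simp [movingFrame]
    linear_combination (Real.cos x * e 0 j + Real.sin x * e 1 j) * Real.sin_sq_add_cos_sq y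
  refine (hasDerivAt_coeff_lineRestrict hA hB f i).congr_deriv ?_
  rw [lineRestrict_dirDeriv_add_smul, lineRestrict_dirDeriv_add_smul,
    lineRestrict_dirDeriv_right, lineRestrict_dirDeriv_left hf, normalCoeff, lineCoeff, lineCoeff]
  rcases i with _ | _ | i
  · simp only [Polynomial.coeff_add, Polynomial.coeff_C_mul, Polynomial.coeff_derivative]
    simp
  · simp [Polynomial.coeff_X_mul, Polynomial.coeff_derivative, mul_sub, mul_add,
      Polynomial.coeff_ofNat_mul]
    ring
  · simp [Polynomial.coeff_X_mul, Polynomial.coeff_derivative, mul_sub, mul_add,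
      Polynomial.coeff_ofNat_mul]
    ring

/-- The Jacobian of the two square conditions at a bitangent, in terms of the normal derivatives at
the two tangency points. -/
lemma jac_of_isSquareWithRoots {f : MvPolynomial (Fin 3) ℝ} (hf : f.IsHomogeneous 4)
    (e : Fin 3 → Fin 3 → ℝ) (p : ℝ × ℝ) {τ₁ τ₂ : ℂ}
    (h : IsSquareWithRoots (lineCoeff f e p) τ₁ τ₂) (h4 : lineCoeff f e p 4 ≠ 0) :
    (jac (fun p => squareU (lineCoeff f e p)) (fun p => squareV (lineCoeff f e p)) p : ℂ) =
      -(512 * Real.cos p.2 * lineCoeff f e p 4 ^ 5 *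
        (Polynomial.aeval τ₁ (lineRestrict (movingFrame e p 0) (movingFrame e p 1)
          (dirDeriv (movingFrame e p 2) f)) *
        Polynomial.aeval τ₂ (lineRestrict (movingFrame e p 0) (movingFrame e p 1)
          (dirDeriv (movingFrame e p 2) f)))) := by
  obtain ⟨x, y⟩ := p
  have hb := natDegree_lineRestrict_le (isHomogeneous_dirDeriv hf (movingFrame e (x, y) 2))
    (movingFrame e (x, y) 0) (movingFrame e (x, y) 1)
  have ha5 : lineCoeff f e (x, y) 5 = 0 := Polynomial.coeff_eq_zero_of_natDegree_lt
    (Nat.lt_succ_of_le (natDegree_lineRestrict_le hf _ _))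
  have hb4 : normalCoeff f e (x, y) 4 = 0 :=
    Polynomial.coeff_eq_zero_of_natDegree_lt (Nat.lt_succ_of_le hb)
  have hG : ∀ t : ℂ, Polynomial.aeval t (lineRestrict (movingFrame e (x, y) 0)
      (movingFrame e (x, y) 1) (dirDeriv (movingFrame e (x, y) 2) f)) =
      normalCoeff f e (x, y) 0 + normalCoeff f e (x, y) 1 * t + normalCoeff f e (x, y) 2 * t ^ 2 +
        normalCoeff f e (x, y) 3 * t ^ 3 := fun t => by
    rw [Polynomial.aeval_eq_sum_range' (Nat.lt_succ_of_le hb)]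
    simp only [Finset.sum_range_succ, Finset.sum_range_zero, Complex.real_smul, normalCoeff,
      lineCoeff]
    ring
  rw [hG, hG, jac,
    fderiv_apply_fst (contDiff_squareU f e) (hasDerivAt_squareU (hasDerivAt_lineCoeff_fst hf e x y)),
    fderiv_apply_fst (contDiff_squareV f e) (hasDerivAt_squareV (hasDerivAt_lineCoeff_fst hf e x y)),
    fderiv_apply_snd (contDiff_squareU f e) (hasDerivAt_squareU (hasDerivAt_lineCoeff_snd f e x y)),
    fderiv_apply_snd (contDiff_squareV f e) (hasDerivAt_squareV (hasDerivAt_lineCoeff_snd f e x y))]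
  obtain ⟨h3, h2, h1, h0⟩ := h
  simp only [Nat.reduceAdd, ha5, hb4]
  norm_num
  rw [h3, h2, h1, h0]
  ring

lemma quartic_coeff_ext {a b : ℕ → ℝ}
    (h : ∀ x y : ℂ, (a 0 : ℂ) * x ^ 4 + a 1 * x ^ 3 * y + a 2 * x ^ 2 * y ^ 2 + a 3 * x * y ^ 3 +
        a 4 * y ^ 4 =
      b 0 * x ^ 4 + b 1 * x ^ 3 * y + b 2 * x ^ 2 * y ^ 2 + b 3 * x * y ^ 3 + b 4 * y ^ 4) :
    a 0 = b 0 ∧ a 1 = b 1 ∧ a 2 = b 2 ∧ a 3 = b 3 ∧ a 4 = b 4 := by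
  have f0 := h 1 0
  have f1 := h 0 1
  have f2 := h 1 1
  have f3 := h 1 (-1)
  have f4 := h 1 2
  have h0 : (a 0 : ℂ) = b 0 := by linear_combination f0
  have h4 : (a 4 : ℂ) = b 4 := by linear_combination f1
  have h2 : (a 2 : ℂ) = b 2 := by linear_combination (f2 + f3) / 2 - h0 - h4
  have h13 : (a 1 : ℂ) + a 3 = b 1 + b 3 := by linear_combination (f2 - f3) / 2
  have h3 : (a 3 : ℂ) = b 3 := by linear_combination (f4 - h0 - 4 * h2 - 16 * h4 - 2 * h13) / 6
  have h1 : (a 1 : ℂ) = b 1 := by linear_combination h13 - h3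
  exact ⟨mod_cast h0, mod_cast h1, mod_cast h2, mod_cast h3, mod_cast h4⟩

lemma lineCoeff_add_pi {f : MvPolynomial (Fin 3) ℝ} (hf : f.IsHomogeneous 4)
    (e : Fin 3 → Fin 3 → ℝ) (x y : ℝ) :
    lineCoeff f e (x + Real.pi, y) 0 = lineCoeff f e (x, -y) 0 ∧
    lineCoeff f e (x + Real.pi, y) 1 = -lineCoeff f e (x, -y) 1 ∧
    lineCoeff f e (x + Real.pi, y) 2 = lineCoeff f e (x, -y) 2 ∧
    lineCoeff f e (x + Real.pi, y) 3 = -lineCoeff f e (x, -y) 3 ∧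
    lineCoeff f e (x + Real.pi, y) 4 = lineCoeff f e (x, -y) 4 := by
  have hA : movingFrame e (x + Real.pi, y) 0 = movingFrame e (x, -y) 0 := by
    ext j; simp [movingFrame]
  have hB : cvec (movingFrame e (x + Real.pi, y) 1) = -cvec (movingFrame e (x, -y) 1) := by
    ext j; simp [movingFrame, cvec]; ring
  have key := quartic_coeff_ext (a := lineCoeff f e (x + Real.pi, y))
    (b := fun i => (-1) ^ i * lineCoeff f e (x, -y) i) fun X Y => by
      have h1 := cev_add_smul hf (movingFrame e (x + Real.pi, y) 0)
        (movingFrame e (x + Real.pi, y) 1) X Y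
      have h2 := cev_add_smul hf (movingFrame e (x, -y) 0) (movingFrame e (x, -y) 1) X (-Y)
      rw [congrArg cvec hA, hB, smul_neg, ← neg_smul, h2] at h1
      simp only [lineCoeff]
      push_cast
      rw [← h1]
      ring
  norm_num at key
  exact key

lemma squareU_add_pi {f : MvPolynomial (Fin 3) ℝ} (hf : f.IsHomogeneous 4)
    (e : Fin 3 → Fin 3 → ℝ) (x y : ℝ) :
    squareU (lineCoeff f e (x + Real.pi, y)) = -squareU (lineCoeff f e (x, -y)) := by
  obtain ⟨-, h1, h2, h3, h4⟩ := lineCoeff_add_pi hf e x y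
  rw [squareU, squareU, h1, h2, h3, h4]
  ring

lemma squareV_add_pi {f : MvPolynomial (Fin 3) ℝ} (hf : f.IsHomogeneous 4)
    (e : Fin 3 → Fin 3 → ℝ) (x y : ℝ) :
    squareV (lineCoeff f e (x + Real.pi, y)) = squareV (lineCoeff f e (x, -y)) := by
  obtain ⟨h0, -, h2, h3, h4⟩ := lineCoeff_add_pi hf e x y
  rw [squareV, squareV, h0, h2, h3, h4]
  ring

lemma cos_four_mul (x : ℝ) : Real.cos (4 * x) =
    Real.cos x ^ 4 - 6 * Real.cos x ^ 2 * Real.sin x ^ 2 + Real.sin x ^ 4 := by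
  have h := Real.sin_sq_add_cos_sq x
  rw [show 4 * x = 2 * (2 * x) by ring, Real.cos_two_mul, Real.cos_two_mul]
  linear_combination (6 * Real.cos x ^ 2 - Real.sin x ^ 2 - (1 - Real.cos x ^ 2)) * h

lemma sin_four_mul (x : ℝ) : Real.sin (4 * x) =
    4 * Real.sin x * Real.cos x * (Real.cos x ^ 2 - Real.sin x ^ 2) := by
  rw [show 4 * x = 2 * (2 * x) by ring, Real.sin_two_mul, Real.sin_two_mul, Real.cos_two_mul']
  ring

section

variable {f : MvPolynomial (Fin 3) ℝ} {e d : Fin 3 → Fin 3 → ℝ} {k : ℝ}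

lemma lineCoeff_four_pos (hf : f.IsHomogeneous 4) (hk : |k| < 1)
    (hnorm : ∀ x y : ℂ, cev f (x • cvec (e 0) + y • cvec (e 1)) =
        (x ^ 2 + y ^ 2) ^ 2 + k * (x ^ 4 - 6 * x ^ 2 * y ^ 2 + y ^ 4)) (p : ℝ × ℝ) :
    0 < lineCoeff f e p 4 := by
  have h1 : lineCoeff f e p 4 = 1 + k * Real.cos (4 * p.1) := by
    have h2 : cvec (movingFrame e p 1) =
        (-Real.sin p.1 : ℂ) • cvec (e 0) + (Real.cos p.1 : ℂ) • cvec (e 1) := by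
      ext j; simp [movingFrame, cvec]
    rw [lineCoeff, coeff_lineRestrict_four hf, cos_four_mul]
    have h3 := hnorm (-Real.sin p.1) (Real.cos p.1)
    rw [← h2, cev_cvec] at h3
    have h4 : (eval (movingFrame e p 1)) f = ((-Real.sin p.1) ^ 2 + Real.cos p.1 ^ 2) ^ 2 +
      k * ((-Real.sin p.1) ^ 4 - 6 * (-Real.sin p.1) ^ 2 * Real.cos p.1 ^ 2 + Real.cos p.1 ^ 4) :=
      by exact_mod_cast h3
    rw [h4, neg_sq, Real.sin_sq_add_cos_sq]
    ring
  have h2 : |k * Real.cos (4 * p.1)| < 1 := by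
    rw [abs_mul]
    exact (mul_le_of_le_one_right (abs_nonneg k) (Real.abs_cos_le_one _)).trans_lt hk
  rw [h1]
  linarith [(abs_lt.1 h2).1]

lemma lineCoeff_pi_div_two (hf : f.IsHomogeneous 4)
    (hnorm : ∀ x y : ℂ, cev f (x • cvec (e 0) + y • cvec (e 1)) =
        (x ^ 2 + y ^ 2) ^ 2 + k * (x ^ 4 - 6 * x ^ 2 * y ^ 2 + y ^ 4)) (x : ℝ) :
    lineCoeff f e (x, Real.pi / 2) 0 = 1 + k * Real.cos (4 * x) ∧
    lineCoeff f e (x, Real.pi / 2) 1 = -4 * k * Real.sin (4 * x) ∧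
    lineCoeff f e (x, Real.pi / 2) 2 = 2 - 6 * k * Real.cos (4 * x) ∧
    lineCoeff f e (x, Real.pi / 2) 3 = 4 * k * Real.sin (4 * x) ∧
    lineCoeff f e (x, Real.pi / 2) 4 = 1 + k * Real.cos (4 * x) := by
  have hA : cvec (movingFrame e (x, Real.pi / 2) 0) =
      (Real.cos x : ℂ) • cvec (e 0) + (Real.sin x : ℂ) • cvec (e 1) := by
    ext j; simp [movingFrame, cvec]
  have hB : cvec (movingFrame e (x, Real.pi / 2) 1) =
      (-Real.sin x : ℂ) • cvec (e 0) + (Real.cos x : ℂ) • cvec (e 1) := by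
    ext j; simp [movingFrame, cvec]
  refine quartic_coeff_ext (b := fun i => ([1 + k * Real.cos (4 * x), -4 * k * Real.sin (4 * x),
    2 - 6 * k * Real.cos (4 * x), 4 * k * Real.sin (4 * x), 1 + k * Real.cos (4 * x)]).getD i 0)
    fun X Y => ?_
  have h1 := cev_add_smul hf (movingFrame e (x, Real.pi / 2) 0) (movingFrame e (x, Real.pi / 2) 1) X Y
  rw [hA, hB, show X • ((Real.cos x : ℂ) • cvec (e 0) + (Real.sin x : ℂ) • cvec (e 1)) +
    Y • ((-Real.sin x : ℂ) • cvec (e 0) + (Real.cos x : ℂ) • cvec (e 1)) =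
    (Real.cos x * X - Real.sin x * Y) • cvec (e 0) +
      (Real.sin x * X + Real.cos x * Y) • cvec (e 1) by module, hnorm] at h1
  have hsc : ((Real.sin x : ℂ)) ^ 2 + (Real.cos x : ℂ) ^ 2 = 1 :=
    by exact_mod_cast Real.sin_sq_add_cos_sq x
  simp only [lineCoeff]
  rw [← h1, cos_four_mul, sin_four_mul]
  simp
  push_cast at hsc
  linear_combination ((X ^ 2 + Y ^ 2) ^ 2) * (Complex.sin x ^ 2 + Complex.cos x ^ 2 + 1) * hsc

lemma squareU_pi_div_two (hf : f.IsHomogeneous 4)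
    (hnorm : ∀ x y : ℂ, cev f (x • cvec (e 0) + y • cvec (e 1)) =
        (x ^ 2 + y ^ 2) ^ 2 + k * (x ^ 4 - 6 * x ^ 2 * y ^ 2 + y ^ 4)) (x : ℝ) :
    squareU (lineCoeff f e (x, Real.pi / 2)) = 64 * k * (1 - k ^ 2) * -Real.sin (4 * x) := by
  obtain ⟨-, h1, h2, h3, h4⟩ := lineCoeff_pi_div_two hf hnorm x
  rw [squareU, h1, h2, h3, h4]
  linear_combination 64 * k ^ 3 * Real.sin (4 * x) * Real.sin_sq_add_cos_sq (4 * x)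

lemma squareV_pi_div_two (hf : f.IsHomogeneous 4)
    (hnorm : ∀ x y : ℂ, cev f (x • cvec (e 0) + y • cvec (e 1)) =
        (x ^ 2 + y ^ 2) ^ 2 + k * (x ^ 4 - 6 * x ^ 2 * y ^ 2 + y ^ 4)) (x : ℝ) :
    squareV (lineCoeff f e (x, Real.pi / 2)) = 64 * k * (1 - k ^ 2) *
      (8 * Real.cos (4 * x) + 4 * k + 4 * k * Real.cos (4 * x) ^ 2) := by
  obtain ⟨h0, -, h2, h3, h4⟩ := lineCoeff_pi_div_two hf hnorm x
  have hs : Real.sin (4 * x) ^ 2 = 1 - Real.cos (4 * x) ^ 2 := by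
    linear_combination Real.sin_sq_add_cos_sq (4 * x)
  have h3' : (4 * k * Real.sin (4 * x)) ^ 2 = 16 * k ^ 2 * (1 - Real.cos (4 * x) ^ 2) := by
    rw [mul_pow, hs]; ring
  rw [squareV, h0, h2, h3, h4, h3']
  ring

/-- The line `V(d 2)` is a bitangent if the quartic restricts to it as `(x ^ 2 + y ^ 2) ^ 2`. -/
lemma isBitangent_of_eq_sq (he : IsFrame e d)
    (hnorm : ∀ x y : ℂ, cev f (x • cvec (e 0) + y • cvec (e 1)) = (x ^ 2 + y ^ 2) ^ 2) :
    IsBitangent f (cvec (d 2)) := by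
  have h0 : ∀ i j, lin (cvec (d i)) (cvec (e j)) = if i = j then 1 else 0 := fun i j => by
    rw [lin_cvec, he]; split_ifs <;> simp
  have hpt : ∀ t : ℂ, cvec (e 0) + t • cvec (e 1) ≠ 0 := fun t hz => by
    have := he.lin_add_smul 1 t 0
    rw [one_smul, hz] at this
    simp [lin] at this
  have hI := Complex.I_mul_I
  refine ⟨cvec (e 0) + Complex.I • cvec (e 1), cvec (e 0) + (-Complex.I) • cvec (e 1),
    cvec_ne_zero fun hd => ?_, hpt _, hpt _, ?_, ?_, cvec (d 0) + Complex.I • cvec (d 1),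
    cvec (d 0) + (-Complex.I) • cvec (d 1), 1, one_ne_zero, ?_, ?_, ⟨cvec (e 0), ?_, ?_⟩,
    ⟨cvec (e 0), ?_, ?_⟩, fun p hp => ?_⟩
  · have := he 2 2
    rw [hd] at this
    simp [lin] at this
  pick_goal 9
  · have h1 := hnorm (lin (cvec (d 0)) p) (lin (cvec (d 1)) p)
    rw [he.eq_of_lin_eq_zero hp] at h1
    rw [h1]
    simp only [lin_add_left, lin_smul_left]
    linear_combination lin (cvec (d 1)) p ^ 2 * (2 * lin (cvec (d 0)) p ^ 2 +
      lin (cvec (d 1)) p ^ 2 - Complex.I * Complex.I * lin (cvec (d 1)) p ^ 2) * hI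
  all_goals simp only [lin_add_right, lin_add_left, lin_smul_left, lin_smul_right, h0]; simp

end

/-! ### Rescaling the quartic -/

section

variable {f : MvPolynomial (Fin 3) ℝ} {σ : ℝ}

lemma Dv_C_mul (σ : ℝ) (f : MvPolynomial (Fin 3) ℝ) (v : Fin 3 → ℝ) (z : Fin 3 → ℂ) :
    Dv (C σ * f) v z = σ * Dv f v z := by
  simp only [Dv, cmap, map_mul, map_C, Finset.mul_sum]
  refine Finset.sum_congr rfl fun i _ => ?_
  simp
  ring

lemma realBitangents_C_mul (hσ : σ ≠ 0) : realBitangents (C σ * f) = realBitangents f := by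
  simp only [realBitangents, IsBitangent, isBitangentAt_C_mul hσ]

lemma hasQtype_C_mul (hσ : σ ≠ 0) {ℓinf : Fin 3 → ℝ} {ℓ : Fin 3 → ℂ} {ε : ℤ} :
    HasQtype (C σ * f) ℓinf ℓ ε ↔ HasQtype f ℓinf ℓ ε := by
  have key : ∀ {σ : ℝ}, σ ≠ 0 → ∀ {f}, HasQtype f ℓinf ℓ ε → HasQtype (C σ * f) ℓinf ℓ ε := by
    rintro σ hσ f ⟨z₁, z₂, v, r, hb, h1, h2, hv, hr, hε⟩
    have hσ2 : 0 < σ ^ 2 := by positivity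
    refine ⟨z₁, z₂, v, σ ^ 2 * r, (isBitangentAt_C_mul hσ).2 hb, h1, h2, hv, ?_, ?_⟩
    · rw [Dv_C_mul, Dv_C_mul]
      push_cast
      linear_combination (σ : ℂ) ^ 2 * hr
    · exact hε.imp (And.imp_left (mul_pos hσ2)) (And.imp_left (mul_neg_of_pos_of_neg hσ2))
  refine ⟨fun h => ?_, key hσ⟩
  have h' := key (inv_ne_zero hσ) h
  rwa [← mul_assoc, ← map_mul, inv_mul_cancel₀ hσ, map_one, one_mul] at h'

lemma SmoothQuartic.C_mul (h : SmoothQuartic f) (hσ : σ ≠ 0) : SmoothQuartic (C σ * f) := by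
  have hσ' : (σ : ℂ) ≠ 0 := by exact_mod_cast hσ
  intro p hp h0
  rw [cev_C_mul, mul_eq_zero, or_iff_right hσ'] at h0
  obtain ⟨i, hi⟩ := h p hp h0
  refine ⟨i, ?_⟩
  simpa [cmap, pderiv_C_mul, hσ'] using hi

end

/-! ### Bitangents in the moving frame -/

section

variable {f : MvPolynomial (Fin 3) ℝ} {e d : Fin 3 → Fin 3 → ℝ} {p : ℝ × ℝ}

lemma lin_movingFrame (he : IsFrame e d) (p : ℝ × ℝ) (x τ : ℂ) :
    lin (cvec (d 2)) (x • (cvec (movingFrame e p 0) + τ • cvec (movingFrame e p 1))) =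
      x * Real.cos p.2 := by
  rw [lin_smul_right, lin_add_right, lin_smul_right, lin_cvec, lin_cvec]
  simp [movingFrame, lin_add_right, lin_smul_right, he _ _, -neg_smul]

lemma IsBitangentAt.lin_ne_zero (hf : f.IsHomogeneous 4) (he : IsFrame e d)
    (h4 : lineCoeff f e p 4 ≠ 0) (hp : Real.cos p.2 ≠ 0) {c : ℂ} (hc : c ≠ 0)
    {z₁ z₂ : Fin 3 → ℂ} (h : IsBitangentAt f (c • cvec (movingFrame d p 2)) z₁ z₂) :
    lin (cvec (d 2)) z₁ ≠ 0 ∧ lin (cvec (d 2)) z₂ ≠ 0 := by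
  have hp' : (Real.cos p.2 : ℂ) ≠ 0 := by exact_mod_cast hp
  rw [lineCoeff, coeff_lineRestrict_four hf] at h4
  obtain ⟨x₁, x₂, τ₁, τ₂, hx₁, hx₂, rfl, rfl, -⟩ := h.exists_roots hf (he.movingFrame p) h4 hc
  rw [lin_movingFrame he, lin_movingFrame he]
  exact ⟨mul_ne_zero hx₁ hp', mul_ne_zero hx₂ hp'⟩

lemma isBitangent_iff (hf : f.IsHomogeneous 4) (he : IsFrame e d)
    (h4 : lineCoeff f e p 4 ≠ 0) {c : ℂ} (hc : c ≠ 0) :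
    IsBitangent f (c • cvec (movingFrame d p 2)) ↔
      squareU (lineCoeff f e p) = 0 ∧ squareV (lineCoeff f e p) = 0 := by
  have h4' := h4
  rw [lineCoeff, coeff_lineRestrict_four hf] at h4'
  constructor
  · rintro ⟨z₁, z₂, h⟩
    obtain ⟨x₁, x₂, τ₁, τ₂, hx₁, hx₂, -, -, hr⟩ := h.exists_roots hf (he.movingFrame p) h4' hc
    exact ⟨hr.squareU_eq_zero, hr.squareV_eq_zero⟩
  · rintro ⟨hu, hv⟩
    obtain ⟨τ₁, τ₂, h⟩ := exists_isSquareWithRoots h4 hu hv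
    exact ⟨_, _, IsSquareWithRoots.isBitangentAt hf (he.movingFrame p) h4' hc h one_ne_zero
      one_ne_zero⟩

lemma aeval_root_eq_zero (hf : f.IsHomogeneous 4) {A B : Fin 3 → ℝ} {τ₁ τ₂ : ℂ}
    (h : IsSquareWithRoots (lineRestrict A B f).coeff τ₁ τ₂) :
    (Polynomial.aeval τ₁ (lineRestrict A B f) = 0 ∧
      Polynomial.aeval τ₁ (Polynomial.derivative (lineRestrict A B f)) = 0) ∧
    (Polynomial.aeval τ₂ (lineRestrict A B f) = 0 ∧
      Polynomial.aeval τ₂ (Polynomial.derivative (lineRestrict A B f)) = 0) := by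
  have h1 := aeval_lineRestrict_eq hf A B h
  refine ⟨⟨?_, ?_⟩, ?_, ?_⟩
  · rw [(h1 _).1]; ring
  · rw [(h1 _).2]; ring
  · rw [(h1 _).1]; ring
  · rw [(h1 _).2]; ring

/-- The Jacobian of the pair of square conditions on the parameter plane. -/
def squareJac (f : MvPolynomial (Fin 3) ℝ) (e : Fin 3 → Fin 3 → ℝ) (p : ℝ × ℝ) : ℝ :=
  jac (fun p => squareU (lineCoeff f e p)) (fun p => squareV (lineCoeff f e p)) p

lemma squareJac_mul_sq (hf : f.IsHomogeneous 4) (he : IsFrame e d) (h4 : lineCoeff f e p 4 ≠ 0)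
    {τ₁ τ₂ x₁ x₂ : ℂ} (h : IsSquareWithRoots (lineCoeff f e p) τ₁ τ₂)
    (hx₁ : x₁ * Real.cos p.2 = 1) (hx₂ : x₂ * Real.cos p.2 = 1) (v : Fin 3 → ℝ) :
    (squareJac f e p : ℂ) * (lin (movingFrame d p 2) v : ℝ) ^ 2 =
      -(512 * Real.cos p.2 ^ 7 * lineCoeff f e p 4 ^ 5 *
        (Dv f v (x₁ • (cvec (movingFrame e p 0) + τ₁ • cvec (movingFrame e p 1))) *
          Dv f v (x₂ • (cvec (movingFrame e p 0) + τ₂ • cvec (movingFrame e p 1))))) := by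
  have h1 := aeval_root_eq_zero hf h
  rw [squareJac, jac_of_isSquareWithRoots hf e p h h4,
    Dv_of_double_root hf (he.movingFrame p) h1.1.1 h1.1.2,
    Dv_of_double_root hf (he.movingFrame p) h1.2.1 h1.2.2]
  have hx₁' : (x₁ * Real.cos p.2) ^ 3 = 1 := by rw [hx₁, one_pow]
  have hx₂' : (x₂ * Real.cos p.2) ^ 3 = 1 := by rw [hx₂, one_pow]
  generalize Polynomial.aeval τ₁ (_ : Polynomial ℝ) = G₁
  generalize Polynomial.aeval τ₂ (_ : Polynomial ℝ) = G₂
  generalize ((lin (movingFrame d p 2) v : ℝ) : ℂ) = l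
  generalize (Real.cos p.2 : ℂ) = c at *
  linear_combination 512 * c * (lineCoeff f e p 4 : ℂ) ^ 5 * G₁ * G₂ * l ^ 2 *
    (hx₁' + (x₁ * c) ^ 3 * hx₂')

lemma squareJac_ne_zero (hf : f.IsHomogeneous 4) (hsm : SmoothQuartic f) (he : IsFrame e d)
    (h4 : lineCoeff f e p 4 ≠ 0) (hp : Real.cos p.2 ≠ 0) (hu : squareU (lineCoeff f e p) = 0)
    (hv : squareV (lineCoeff f e p) = 0) : squareJac f e p ≠ 0 := by
  obtain ⟨τ₁, τ₂, h⟩ := exists_isSquareWithRoots h4 hu hv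
  have h1 := aeval_root_eq_zero hf h
  have hm := he.movingFrame p
  have hp' : (Real.cos p.2 : ℂ) ≠ 0 := by exact_mod_cast hp
  have h4' : (lineCoeff f e p 4 : ℂ) ≠ 0 := by exact_mod_cast h4
  have key := jac_of_isSquareWithRoots hf e p h h4
  intro h0
  rw [squareJac] at h0
  rw [h0, Complex.ofReal_zero, zero_eq_neg] at key
  exact mul_ne_zero (mul_ne_zero (mul_ne_zero (by norm_num) hp') (pow_ne_zero 5 h4'))
    (mul_ne_zero (aeval_normal_ne_zero hf hsm hm h1.1.1 h1.1.2)
      (aeval_normal_ne_zero hf hsm hm h1.2.1 h1.2.2)) key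

lemma hasQtype_iff (hf : f.IsHomogeneous 4) (hsm : SmoothQuartic f) (he : IsFrame e d)
    (h4 : 0 < lineCoeff f e p 4) (hp : 0 < Real.cos p.2) (hu : squareU (lineCoeff f e p) = 0)
    (hv : squareV (lineCoeff f e p) = 0) {c : ℂ} (hc : c ≠ 0) {ε : ℤ} :
    HasQtype f (d 2) (c • cvec (movingFrame d p 2)) ε ↔
      ε = -(SignType.sign (squareJac f e p) : ℤ) := by
  have hJ := squareJac_ne_zero hf hsm he h4.ne' hp.ne' hu hv
  have h4' := h4.ne'
  rw [lineCoeff, coeff_lineRestrict_four hf] at h4'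
  have hpos : 0 < 512 * Real.cos p.2 ^ 7 * lineCoeff f e p 4 ^ 5 := by positivity
  have hsign : ∀ {l r : ℝ}, l ≠ 0 → squareJac f e p * l ^ 2 =
      -(512 * Real.cos p.2 ^ 7 * lineCoeff f e p 4 ^ 5 * r) →
      ((0 < r ∧ ε = 1 ∨ r < 0 ∧ ε = -1) ↔ ε = -(SignType.sign (squareJac f e p) : ℤ)) := by
    intro l r hl h
    have hl2 : 0 < l ^ 2 := by positivity
    rcases hJ.lt_or_gt with hJ' | hJ'
    · have hr : 0 < r := by
        refine pos_of_mul_pos_right (a := 512 * Real.cos p.2 ^ 7 * lineCoeff f e p 4 ^ 5) ?_ hpos.le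
        nlinarith [mul_neg_of_neg_of_pos hJ' hl2]
      simp [sign_neg hJ', hr, hr.le.not_gt]
    · have hr : r < 0 := by
        refine neg_of_mul_neg_right (a := 512 * Real.cos p.2 ^ 7 * lineCoeff f e p 4 ^ 5) ?_ hpos.le
        nlinarith [mul_pos hJ' hl2]
      simp [sign_pos hJ', hr, hr.le.not_gt]
  constructor
  · rintro ⟨z₁, z₂, v, r, hb, h1, h2, hlv, hr, hε⟩
    obtain ⟨x₁, x₂, τ₁, τ₂, -, -, rfl, rfl, h⟩ := hb.exists_roots hf (he.movingFrame p) h4' hc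
    rw [lin_movingFrame he] at h1 h2
    rw [lin_smul_left, lin_cvec] at hlv
    have key := squareJac_mul_sq hf he h4.ne' h h1 h2 v
    rw [hr] at key
    refine (hsign (l := lin (movingFrame d p 2) v) (fun h0 => hlv ?_) ?_).1 hε
    · rw [h0]; simp
    · exact_mod_cast key
  · intro hε
    obtain ⟨τ₁, τ₂, h⟩ := exists_isSquareWithRoots h4.ne' hu hv
    have hcos : (Real.cos p.2 : ℂ) ≠ 0 := by exact_mod_cast hp.ne'
    have hx : (Real.cos p.2 : ℂ)⁻¹ * Real.cos p.2 = 1 := inv_mul_cancel₀ hcos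
    have key := squareJac_mul_sq hf he h4.ne' h hx hx (movingFrame e p 2)
    have hl : lin (movingFrame d p 2) (movingFrame e p 2) = 1 := by
      rw [he.movingFrame p]; simp
    have hr : squareJac f e p * 1 ^ 2 = -(512 * Real.cos p.2 ^ 7 * lineCoeff f e p 4 ^ 5 *
        (-squareJac f e p / (512 * Real.cos p.2 ^ 7 * lineCoeff f e p 4 ^ 5))) := by
      field_simp
    refine ⟨_, _, movingFrame e p 2, _, IsSquareWithRoots.isBitangentAt hf (he.movingFrame p) h4' hc h
      (inv_ne_zero hcos) (inv_ne_zero hcos), ?_, ?_, ?_, ?_, (hsign one_ne_zero hr).2 hε⟩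
    · rw [lin_movingFrame he, hx]
    · rw [lin_movingFrame he, hx]
    · rw [lin_smul_left, lin_cvec, hl]; simpa using hc
    · generalize Dv f (movingFrame e p 2) _ = D₁ at *
      generalize Dv f (movingFrame e p 2) _ = D₂ at *
      rw [hl] at key
      have hpos' : (512 * Real.cos p.2 ^ 7 * lineCoeff f e p 4 ^ 5 : ℂ) ≠ 0 := by
        exact_mod_cast hpos.ne'
      push_cast at key hpos' ⊢
      rw [eq_div_iff hpos']
      linear_combination key

end

/-! ### The moving frame parametrizes the affine lines -/

section

variable {e d : Fin 3 → Fin 3 → ℝ}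

lemma IsFrame.ne_zero (h : IsFrame e d) : d 2 ≠ 0 := fun h0 => by
  have := h 2 2
  rw [h0] at this
  simp [lin] at this

lemma lin_movingFrame_two (h : IsFrame e d) (p : ℝ × ℝ) (i : Fin 3) :
    lin (movingFrame d p 2) (e i) =
      ![Real.cos p.2 * Real.cos p.1, Real.cos p.2 * Real.sin p.1, -Real.sin p.2] i := by
  fin_cases i <;>
    simp [movingFrame, lin_add_left, lin_smul_left, h _ _, sub_eq_add_neg, ← neg_smul]

lemma movingFrame_injective (h : IsFrame e d) {p q : ℝ × ℝ} {c : ℝ}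
    (h1 : |p.1 - q.1| < Real.pi) (hp : p.2 ∈ Set.Ioo (-(Real.pi / 2)) (Real.pi / 2))
    (hq : q.2 ∈ Set.Ioo (-(Real.pi / 2)) (Real.pi / 2))
    (hc : movingFrame d p 2 = c • movingFrame d q 2) : p = q := by
  have key : ∀ i, _ := fun i => congrArg (fun l => lin l (e i)) hc
  simp only [lin_smul_left, lin_movingFrame_two h] at key
  have k0 := key 0
  have k1 := key 1
  have k2 := key 2
  simp only [Matrix.cons_val] at k0 k1 k2
  have hcos := Real.cos_pos_of_mem_Ioo hp
  obtain ⟨h1l, h1r⟩ := abs_lt.1 h1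
  have hθ : p.1 = q.1 := by
    rw [← sub_eq_zero, ← Real.sin_eq_zero_iff_of_lt_of_lt h1l h1r, Real.sin_sub]
    refine (mul_eq_zero.1 (?_ : Real.cos p.2 * _ = 0)).resolve_left hcos.ne'
    linear_combination Real.cos q.1 * k1 - Real.sin q.1 * k0
  have hk : Real.cos p.2 = c * Real.cos q.2 := by
    rw [hθ] at k0 k1
    linear_combination Real.cos q.1 * k0 + Real.sin q.1 * k1 +
      (c * Real.cos q.2 - Real.cos p.2) * Real.sin_sq_add_cos_sq q.1
  refine Prod.ext hθ ?_
  rw [← sub_eq_zero, ← Real.sin_eq_zero_iff_of_lt_of_lt (by linarith [hp.1, hq.2])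
    (by linarith [hp.2, hq.1]), Real.sin_sub]
  linear_combination -Real.cos q.2 * k2 - Real.sin q.2 * hk

lemma exists_eq_smul_movingFrame (h : IsFrame e d) {w : Fin 3 → ℝ}
    (hw : ∀ c : ℝ, w ≠ c • d 2) (α : ℝ) :
    ∃ p ∈ Set.Ico α (α + Real.pi) ×ˢ Set.Ioo (-(Real.pi / 2)) (Real.pi / 2), ∃ c : ℝ,
      c ≠ 0 ∧ w = c • movingFrame d p 2 := by
  have hdec := h.decomp_left w
  rw [Fin.sum_univ_three] at hdec
  set z : ℂ := ⟨lin w (e 0), lin w (e 1)⟩ with hz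
  have hz0 : z ≠ 0 := fun h0 => by
    refine hw (lin w (e 2)) ?_
    have hre : lin w (e 0) = 0 := congrArg Complex.re h0
    have him : lin w (e 1) = 0 := congrArg Complex.im h0
    conv_lhs => rw [← hdec, hre, him]
    simp
  set n := toIcoDiv Real.pi_pos α z.arg
  have hmem : z.arg - n * Real.pi ∈ Set.Ico α (α + Real.pi) := by
    rw [← zsmul_eq_mul]
    exact sub_toIcoDiv_zsmul_mem_Ico Real.pi_pos α z.arg
  set θ := z.arg - n * Real.pi with hθ
  set r : ℝ := (-1) ^ n * ‖z‖ with hr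
  have hr0 : r ≠ 0 := mul_ne_zero (zpow_ne_zero _ (by norm_num)) (norm_ne_zero_iff.2 hz0)
  have hsq : ((-1 : ℝ) ^ n) * (-1) ^ n = 1 := by
    rw [← mul_zpow]; norm_num
  have ha : lin w (e 0) = r * Real.cos θ := by
    rw [hθ, Real.cos_sub_int_mul_pi, hr]
    linear_combination -Complex.norm_mul_cos_arg z - ‖z‖ * Real.cos z.arg * hsq
  have hb : lin w (e 1) = r * Real.sin θ := by
    rw [hθ, Real.sin_sub_int_mul_pi, hr]
    linear_combination -Complex.norm_mul_sin_arg z - ‖z‖ * Real.sin z.arg * hsq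
  set φ := Real.arctan (-lin w (e 2) / r) with hφ
  have hcos : 0 < Real.cos φ := Real.cos_arctan_pos _
  have htan : Real.sin φ * r = -lin w (e 2) * Real.cos φ := by
    have := Real.tan_arctan (-lin w (e 2) / r)
    rw [← hφ, Real.tan_eq_sin_div_cos] at this
    field_simp at this
    linear_combination this
  refine ⟨(θ, φ), ⟨hmem, Real.arctan_mem_Ioo _⟩, r / Real.cos φ, div_ne_zero hr0 hcos.ne', ?_⟩
  rw [← hdec, ha, hb]
  ext j
  simp [movingFrame]
  field_simp
  linear_combination d 2 j * htan

end

lemma IsBitangent.smul {f : MvPolynomial (Fin 3) ℝ} {ℓ : Fin 3 → ℂ} {c : ℂ} (hc : c ≠ 0)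
    (h : IsBitangent f (c • ℓ)) : IsBitangent f ℓ := by
  obtain ⟨z₁, z₂, h⟩ := h
  simp only [IsBitangentAt, lin_smul_left, mul_eq_zero, hc, false_or] at h
  exact ⟨z₁, z₂, fun h0 => h.1 (by rw [h0, smul_zero]), h.2⟩

/-! ### The signed count -/

lemma card_sub_card_of_sum_sign {ι : Type*} (Z : Finset ι) (J : ι → ℝ) {m : ℤ}
    (h : ∑ p ∈ Z, (SignType.sign (J p) : ℝ) = m) :
    ((Z.filter fun p => 0 < J p).card : ℤ) - (Z.filter fun p => J p < 0).card = m := by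
  have h1 : ∀ p ∈ Z, (SignType.sign (J p) : ℝ) =
      (if 0 < J p then 1 else 0) - (if J p < 0 then 1 else 0) := fun p _ => by
    rcases lt_trichotomy (J p) 0 with hJ | hJ | hJ
    · simp [hJ, hJ.le.not_gt]
    · simp [hJ]
    · simp [hJ, hJ.le.not_gt]
  rw [Finset.sum_congr rfl h1, Finset.sum_sub_distrib, Finset.sum_boole, Finset.sum_boole] at h
  exact_mod_cast h

section

variable {f : MvPolynomial (Fin 3) ℝ} {e d : Fin 3 → Fin 3 → ℝ} {k : ℝ}

lemma mem_Ioo_of_square_zero (hf : f.IsHomogeneous 4) (hk : |k| < 1) (hk0 : k ≠ 0)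
    (hnorm : ∀ x y : ℂ, cev f (x • cvec (e 0) + y • cvec (e 1)) =
        (x ^ 2 + y ^ 2) ^ 2 + k * (x ^ 4 - 6 * x ^ 2 * y ^ 2 + y ^ 4)) {p : ℝ × ℝ}
    (hp : p.2 ∈ Set.Icc (-(Real.pi / 2)) (Real.pi / 2)) (hu : squareU (lineCoeff f e p) = 0)
    (hv : squareV (lineCoeff f e p) = 0) : p.2 ∈ Set.Ioo (-(Real.pi / 2)) (Real.pi / 2) := by
  have hl : 64 * k * (1 - k ^ 2) ≠ 0 := by
    have : k ^ 2 < 1 := (sq_lt_one_iff_abs_lt_one k).2 hk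
    exact mul_ne_zero (mul_ne_zero (by norm_num) hk0) (by linarith)
  have top : ∀ x, squareU (lineCoeff f e (x, Real.pi / 2)) = 0 →
      squareV (lineCoeff f e (x, Real.pi / 2)) = 0 → False := fun x h1 h2 => by
    rw [squareU_pi_div_two hf hnorm, mul_eq_zero, or_iff_right hl, neg_eq_zero] at h1
    rw [squareV_pi_div_two hf hnorm, mul_eq_zero, or_iff_right hl] at h2
    exact boundary_curve_ne_zero hk h1 h2
  obtain ⟨x, y⟩ := p
  refine ⟨hp.1.lt_of_ne fun hy => ?_, hp.2.lt_of_ne fun hy => ?_⟩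
  · simp only [] at hy
    subst hy
    exact top (x + Real.pi) (by rw [squareU_add_pi hf, hu, neg_zero]) (by rw [squareV_add_pi hf, hv])
  · simp only [] at hy
    subst hy
    exact top x hu hv

/-- In an adapted frame, some vertical strip of width `π` contains finitely many zeros of the square
conditions, all in the interior, and their signed count is `-4`. -/
lemma exists_strip (hf : f.IsHomogeneous 4) (hsm : SmoothQuartic f) (he : IsFrame e d)
    (hk : |k| < 1) (hk0 : k ≠ 0)
    (hnorm : ∀ x y : ℂ, cev f (x • cvec (e 0) + y • cvec (e 1)) =
        (x ^ 2 + y ^ 2) ^ 2 + k * (x ^ 4 - 6 * x ^ 2 * y ^ 2 + y ^ 4)) :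
    ∃ (α : ℝ) (Z : Finset (ℝ × ℝ)),
      (∀ p ∈ Set.Ico α (α + Real.pi) ×ˢ Set.Ioo (-(Real.pi / 2)) (Real.pi / 2),
        squareU (lineCoeff f e p) = 0 → squareV (lineCoeff f e p) = 0 → p ∈ Z) ∧
      (∀ p ∈ Z, p ∈ Set.Ioo α (α + Real.pi) ×ˢ Set.Ioo (-(Real.pi / 2)) (Real.pi / 2) ∧
        squareU (lineCoeff f e p) = 0 ∧ squareV (lineCoeff f e p) = 0) ∧
      ∑ p ∈ Z, (SignType.sign (squareJac f e p) : ℝ) = -4 := by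
  set u : ℝ × ℝ → ℝ := fun p => squareU (lineCoeff f e p) with hu
  set v : ℝ × ℝ → ℝ := fun p => squareV (lineCoeff f e p) with hv
  have hut : ∀ x y, u (x + Real.pi, y) = -u (x, -y) := squareU_add_pi hf e
  have hvt : ∀ x y, v (x + Real.pi, y) = v (x, -y) := squareV_add_pi hf e
  have hl : 64 * k * (1 - k ^ 2) ≠ 0 := by
    have : k ^ 2 < 1 := (sq_lt_one_iff_abs_lt_one k).2 hk
    exact mul_ne_zero (mul_ne_zero (by norm_num) hk0) (by linarith)
  have hIoo : ∀ p : ℝ × ℝ, p.2 ∈ Set.Icc (-(Real.pi / 2)) (Real.pi / 2) → u p = 0 → v p = 0 →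
      p.2 ∈ Set.Ioo (-(Real.pi / 2)) (Real.pi / 2) := fun p =>
    mem_Ioo_of_square_zero hf hk hk0 hnorm
  have hJ : ∀ p : ℝ × ℝ, p.2 ∈ Set.Icc (-(Real.pi / 2)) (Real.pi / 2) → u p = 0 → v p = 0 →
      jac u v p ≠ 0 := fun p hp h1 h2 =>
    squareJac_ne_zero hf hsm he (lineCoeff_four_pos hf hk hnorm p).ne'
      (Real.cos_pos_of_mem_Ioo (hIoo p hp h1 h2)).ne' h1 h2
  have hfin : ∀ a b : ℝ, {p ∈ Set.Icc (a, -(Real.pi / 2)) (b, Real.pi / 2) |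
      u p = 0 ∧ v p = 0}.Finite := fun a b =>
    finite_zeros (contDiff_squareU f e) (contDiff_squareV f e) isCompact_Icc
      fun p hp => hJ p ⟨hp.1.2, hp.2.2⟩
  obtain ⟨α, hα, hαZ⟩ := (Set.Ioo_infinite Real.pi_pos).exists_notMem_finite
    ((hfin 0 Real.pi).image Prod.fst)
  have hα' : ∀ y ∈ Set.Icc (-(Real.pi / 2)) (Real.pi / 2), u (α, y) = 0 → v (α, y) = 0 → False :=
    fun y hy h1 h2 => hαZ ⟨(α, y), ⟨⟨⟨hα.1.le, hy.1⟩, hα.2.le, hy.2⟩, h1, h2⟩, rfl⟩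
  have hmem := fun p => (hfin α (α + Real.pi)).mem_toFinset (a := p)
  have hZ : ∀ p ∈ (hfin α (α + Real.pi)).toFinset,
      p ∈ Set.Ioo α (α + Real.pi) ×ˢ Set.Ioo (-(Real.pi / 2)) (Real.pi / 2) ∧ u p = 0 ∧ v p = 0 := by
    rintro ⟨x, y⟩ hp
    obtain ⟨⟨⟨hx1, hy1⟩, hx2, hy2⟩, h1, h2⟩ := (hmem _).1 hp
    simp only at hx1 hx2 hy1 hy2
    refine ⟨⟨⟨hx1.lt_of_ne fun h => ?_, hx2.lt_of_ne fun h => ?_⟩, hIoo _ ⟨hy1, hy2⟩ h1 h2⟩, h1, h2⟩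
    · subst h
      exact hα' y ⟨hy1, hy2⟩ h1 h2
    · rw [h, hut, neg_eq_zero] at h1
      rw [h, hvt] at h2
      exact hα' (-y) ⟨by linarith, by linarith⟩ h1 h2
  refine ⟨α, (hfin α (α + Real.pi)).toFinset, fun p hp h1 h2 => (hmem p).2
    ⟨⟨⟨hp.1.1, hp.2.1.le⟩, hp.1.2.le, hp.2.2.le⟩, h1, h2⟩, hZ, ?_⟩
  exact sum_sign_moebius (contDiff_squareU f e) (contDiff_squareV f e) hut hvt hk hl
    (squareU_pi_div_two hf hnorm) (squareV_pi_div_two hf hnorm) α _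
    (fun p hp => ⟨(hZ p hp).1, (hZ p hp).2.1, (hZ p hp).2.2,
      hJ p (Set.Ioo_subset_Icc_self (hZ p hp).1.2) (hZ p hp).2.1 (hZ p hp).2.2⟩)
    fun p hp h1 h2 => (hmem p).2 ⟨hp, h1, h2⟩

end

/-- The signed count of real bitangents in an adapted frame. -/
theorem bitangent_count {f : MvPolynomial (Fin 3) ℝ} {e d : Fin 3 → Fin 3 → ℝ} {k : ℝ}
    (hf : f.IsHomogeneous 4) (hsm : SmoothQuartic f) (he : IsFrame e d)
    (hnb : ¬ IsBitangent f (cvec (d 2))) (hk : |k| < 1)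
    (hnorm : ∀ x y : ℂ, cev f (x • cvec (e 0) + y • cvec (e 1)) =
        (x ^ 2 + y ^ 2) ^ 2 + k * (x ^ 4 - 6 * x ^ 2 * y ^ 2 + y ^ 4)) :
    (realBitangents f).Finite ∧
    (∀ L ∈ realBitangents f, ∀ z₁ z₂ : Fin 3 → ℂ,
        IsBitangentAt f (cvec L.rep) z₁ z₂ →
        lin (cvec (d 2)) z₁ ≠ 0 ∧ lin (cvec (d 2)) z₂ ≠ 0) ∧
    (∀ L ∈ realBitangents f, ∃! ε : ℤ, HasQtype f (d 2) (cvec L.rep) ε) ∧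
    ({L ∈ realBitangents f | HasQtype f (d 2) (cvec L.rep) 1}.ncard : ℤ) -
      ({L ∈ realBitangents f | HasQtype f (d 2) (cvec L.rep) (-1)}.ncard : ℤ) = 4 := by
  have hk0 : k ≠ 0 := by
    rintro rfl
    exact hnb (isBitangent_of_eq_sq he fun x y => by rw [hnorm]; simp)
  obtain ⟨α, Z, hZ', hZ, hsum⟩ := exists_strip hf hsm he hk hk0 hnorm
  have h4 := lineCoeff_four_pos hf hk hnorm
  let g : ℝ × ℝ → Projectivization ℝ (Fin 3 → ℝ) := fun p =>
    Projectivization.mk ℝ (movingFrame d p 2) (he.movingFrame p).ne_zero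
  have hrep : ∀ p, ∃ c : ℂ, c ≠ 0 ∧ cvec (g p).rep = c • cvec (movingFrame d p 2) := fun p => by
    obtain ⟨a, ha⟩ := Projectivization.exists_smul_eq_mk_rep ℝ (movingFrame d p 2)
      (he.movingFrame p).ne_zero
    exact ⟨((a : ℝ) : ℂ), by exact_mod_cast a.ne_zero, by rw [← ha, Units.smul_def, cvec_smul]⟩
  have hinj : Set.InjOn g Z := fun p hp q hq hpq => by
    obtain ⟨a, ha⟩ := (Projectivization.mk_eq_mk_iff ℝ _ _ _ _).1 hpq
    have hp' := (hZ p hp).1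
    have hq' := (hZ q hq).1
    exact movingFrame_injective he (abs_lt.2 ⟨by linarith [hp'.1.1, hq'.1.2],
      by linarith [hp'.1.2, hq'.1.1]⟩) hp'.2 hq'.2 ha.symm
  have himage : realBitangents f = g '' Z := by
    ext L
    constructor
    · intro hL
      have hL' : IsBitangent f (cvec L.rep) := hL
      obtain ⟨p, hp, c, hc, hLp⟩ := exists_eq_smul_movingFrame he (w := L.rep) (fun c hc => by
        rw [hc, cvec_smul] at hL'
        refine hnb (hL'.smul ?_)
        rintro h0
        rw [Complex.ofReal_eq_zero] at h0
        exact L.rep_nonzero (by rw [hc, h0, zero_smul])) α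
      rw [hLp, cvec_smul] at hL'
      obtain ⟨hu, hv⟩ := (isBitangent_iff hf he (h4 p).ne' (by exact_mod_cast hc)).1 hL'
      refine ⟨p, hZ' p hp hu hv, ?_⟩
      rw [← L.mk_rep]
      exact (Projectivization.mk_eq_mk_iff' ℝ _ _ _ _).2 ⟨c⁻¹, by rw [hLp, inv_smul_smul₀ hc]⟩
    · rintro ⟨p, hp, rfl⟩
      obtain ⟨c, hc, hgc⟩ := hrep p
      change IsBitangent f (cvec (g p).rep)
      rw [hgc]
      exact (isBitangent_iff hf he (h4 p).ne' hc).2 (hZ p hp).2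
  have hcos : ∀ p ∈ Z, 0 < Real.cos p.2 := fun p hp => Real.cos_pos_of_mem_Ioo (hZ p hp).1.2
  have hQ : ∀ p ∈ Z, ∀ ε : ℤ, HasQtype f (d 2) (cvec (g p).rep) ε ↔
      ε = -(SignType.sign (squareJac f e p) : ℤ) := fun p hp ε => by
    obtain ⟨c, hc, hgc⟩ := hrep p
    rw [hgc]
    exact hasQtype_iff hf hsm he (h4 p) (hcos p hp) (hZ p hp).2.1 (hZ p hp).2.2 hc
  have hncard : ∀ (ε : ℤ) (P : ℝ × ℝ → Prop) [DecidablePred P],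
      (∀ p ∈ Z, ε = -(SignType.sign (squareJac f e p) : ℤ) ↔ P p) →
      {L ∈ realBitangents f | HasQtype f (d 2) (cvec L.rep) ε}.ncard = (Z.filter P).card := by
    intro ε P _ hP
    rw [← Set.ncard_coe_finset, ← (hinj.mono (Z.filter_subset P)).ncard_image, himage]
    congr 1
    ext L
    simp only [Set.mem_image, Set.mem_ofPred_eq, Finset.mem_coe, Finset.mem_filter]
    constructor
    · rintro ⟨⟨p, hp, rfl⟩, hL⟩
      exact ⟨p, ⟨hp, (hP p hp).1 ((hQ p hp ε).1 hL)⟩, rfl⟩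
    · rintro ⟨p, ⟨hp, hPp⟩, rfl⟩
      exact ⟨⟨p, hp, rfl⟩, (hQ p hp ε).2 ((hP p hp).2 hPp)⟩
  have hsign : ∀ x : ℝ, ((1 : ℤ) = -(SignType.sign x : ℤ) ↔ x < 0) ∧
      ((-1 : ℤ) = -(SignType.sign x : ℤ) ↔ 0 < x) := fun x => by
    rcases lt_trichotomy x 0 with h | h | h
    · simp [h, h.le.not_gt]
    · simp [h]
    · simp [h, h.le.not_gt]
  refine ⟨himage ▸ (Z.finite_toSet.image g), ?_, ?_, ?_⟩
  · rw [himage]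
    rintro _ ⟨p, hp, rfl⟩ z₁ z₂ hz
    obtain ⟨c, hc, hgc⟩ := hrep p
    rw [hgc] at hz
    exact hz.lin_ne_zero hf he (h4 p).ne' (hcos p hp).ne' hc
  · rw [himage]
    rintro _ ⟨p, hp, rfl⟩
    exact ⟨_, (hQ p hp _).2 rfl, fun ε hε => (hQ p hp ε).1 hε⟩
  · rw [hncard 1 _ fun p _ => (hsign (squareJac f e p)).1,
      hncard (-1) _ fun p _ => (hsign (squareJac f e p)).2]
    have := card_sub_card_of_sum_sign Z (squareJac f e) (m := -4) (by rw [hsum]; norm_num)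
    linarith

/-- For a smooth real plane quartic with no real point on the real
line `L∞ = V(ℓ∞)`, where `L∞` is not itself a bitangent: there are finitely many real
bitangents, every real bitangent has its tangency points off `L∞` (so its Qtype is
defined, and uniquely so), and #{Qtype = +1} − #{Qtype = −1} = 4. -/
theorem statement0 (f : MvPolynomial (Fin 3) ℝ) (hf : f.IsHomogeneous 4)
    (hsm : SmoothQuartic f)
    (ℓinf : Fin 3 → ℝ) (hinf : ℓinf ≠ 0)
    (hno : ∀ p : Fin 3 → ℝ, p ≠ 0 → lin ℓinf p = 0 → eval p f ≠ 0)
    (hnb : ¬ IsBitangent f (cvec ℓinf)) :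
    (realBitangents f).Finite ∧
    (∀ L ∈ realBitangents f, ∀ z₁ z₂ : Fin 3 → ℂ,
        IsBitangentAt f (cvec L.rep) z₁ z₂ →
        lin (cvec ℓinf) z₁ ≠ 0 ∧ lin (cvec ℓinf) z₂ ≠ 0) ∧
    (∀ L ∈ realBitangents f, ∃! ε : ℤ, HasQtype f ℓinf (cvec L.rep) ε) ∧
    ({L ∈ realBitangents f | HasQtype f ℓinf (cvec L.rep) 1}.ncard : ℤ) -
      ({L ∈ realBitangents f | HasQtype f ℓinf (cvec L.rep) (-1)}.ncard : ℤ) = 4 := by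
  obtain ⟨e, d, σ, k, he, rfl, hσ, hk, hnorm⟩ := exists_adapted_frame hf hinf hno
  have hnb' : ¬ IsBitangent (C σ * f) (cvec (d 2)) := by
    simpa only [IsBitangent, isBitangentAt_C_mul hσ] using hnb
  have hhom : (C σ * f).IsHomogeneous 4 := by
    simpa using (isHomogeneous_C (Fin 3) σ).mul hf
  have := bitangent_count hhom (hsm.C_mul hσ) he hnb' hk hnorm
  simpa only [realBitangents_C_mul hσ, isBitangentAt_C_mul hσ, hasQtype_C_mul hσ] using this


end
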